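/- Let 0 < α ≤ 1/2 and R > 0, and let K = K(α, R) be the bowtie set. Then for every function f continuous on K and analytic on the interior of K there exist a constant C ≥ 1 and a sequence of polynomials (p_n)_{n≥1} with deg p_n ≤ n such that sup_{z∈K} |f(z) − p_n(z)| ≤ C · E_n(f, K) for all n, and for every compact set E contained in the interior of K there exists c > 0 (depending on E) such that e^{c n} · sup_{z∈E} |f(z) − p_n(z)| → 0 as n → ∞. -/

import Mathlib

open Filter

/-- The bowtie set: union of the two closed circular sectors of radius `R` and
half-angle `α π / 2` around the positive and negative real axis. -/
noncomputable def bowtie (α R : ℝ) : Set ℂ :=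
  {z : ℂ | ∃ r θ : ℝ, 0 ≤ r ∧ r ≤ R ∧
    (|θ| ≤ α * Real.pi / 2 ∨ |θ - Real.pi| ≤ α * Real.pi / 2) ∧
    z = r * Complex.exp (θ * Complex.I)}

/-- Sup of `|f - P|` over a set `E`. -/
noncomputable def supErr (f : ℂ → ℂ) (E : Set ℂ) (P : Polynomial ℂ) : ℝ :=
  ⨆ z : E, ‖f z - P.eval (z : ℂ)‖

/-- `E_n(f, K)`: best uniform polynomial approximation error of degree at most `n`. -/
noncomputable def bestE (f : ℂ → ℂ) (K : Set ℂ) (n : ℕ) : ℝ :=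
  ⨅ P : {P : Polynomial ℂ // P.natDegree ≤ n}, supErr f K P.1



open Complex in
/-- closed sector -/
def sec (b R : ℝ) : Set ℂ :=
  {w | 0 ≤ Real.sin b * w.re - Real.cos b * w.im ∧ 0 ≤ Real.sin b * w.re + Real.cos b * w.im ∧
    ‖w‖ ≤ R}

/-- open sector -/
def osec (b R : ℝ) : Set ℂ :=
  {w | 0 < Real.sin b * w.re - Real.cos b * w.im ∧ 0 < Real.sin b * w.re + Real.cos b * w.im ∧
    ‖w‖ < R}

theorem osec_subset_sec (b R : ℝ) : osec b R ⊆ sec b R :=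
  fun _ h => ⟨h.1.le, h.2.1.le, h.2.2.le⟩

theorem isOpen_osec (b R : ℝ) : IsOpen (osec b R) := by
  have h1 : IsOpen {w : ℂ | 0 < Real.sin b * w.re - Real.cos b * w.im} :=
    isOpen_lt (by fun_prop) (by fun_prop)
  have h2 : IsOpen {w : ℂ | 0 < Real.sin b * w.re + Real.cos b * w.im} :=
    isOpen_lt (by fun_prop) (by fun_prop)
  have h3 : IsOpen {w : ℂ | ‖w‖ < R} :=
    isOpen_lt (by fun_prop) (by fun_prop)
  exact h1.inter (h2.inter h3)

theorem convex_sec (b R : ℝ) : Convex ℝ (sec b R) := by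
  intro x hx y hy p q hp hq hpq
  obtain ⟨h1, h2, h3⟩ := hx
  obtain ⟨k1, k2, k3⟩ := hy
  refine ⟨?_, ?_, ?_⟩
  · have := add_nonneg (mul_nonneg hp h1) (mul_nonneg hq k1)
    simp; linarith
  · have := add_nonneg (mul_nonneg hp h2) (mul_nonneg hq k2)
    simp; linarith
  · calc ‖p • x + q • y‖ ≤ ‖p • x‖ + ‖q • y‖ := norm_add_le _ _
      _ = p * ‖x‖ + q * ‖y‖ := by rw [norm_smul, norm_smul, Real.norm_of_nonneg hp, Real.norm_of_nonneg hq]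
      _ ≤ p * R + q * R := by gcongr
      _ = R := by rw [← add_mul, hpq, one_mul]

theorem comb_mem_osec {b R : ℝ} {x y : ℂ} (hx : x ∈ sec b R) (hy : y ∈ osec b R) {p q : ℝ}
    (hp : 0 ≤ p) (hq : 0 < q) (hpq : p + q = 1) : (p : ℂ) * x + q * y ∈ osec b R := by
  obtain ⟨h1, h2, h3⟩ := hx
  obtain ⟨k1, k2, k3⟩ := hy
  refine ⟨?_, ?_, ?_⟩
  · have := add_pos_of_nonneg_of_pos (mul_nonneg hp h1) (mul_pos hq k1)
    simp; linarith
  · have := add_pos_of_nonneg_of_pos (mul_nonneg hp h2) (mul_pos hq k2)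
    simp; linarith
  · calc ‖(p : ℂ) * x + q * y‖ ≤ ‖(p : ℂ) * x‖ + ‖(q : ℂ) * y‖ := norm_add_le _ _
      _ = p * ‖x‖ + q * ‖y‖ := by
        rw [norm_mul, norm_mul, Complex.norm_of_nonneg hp, Complex.norm_of_nonneg hq.le]
      _ < p * R + q * R := by
        have := mul_lt_mul_of_pos_left k3 hq
        have := mul_le_mul_of_nonneg_left h3 hp
        linarith
      _ = R := by rw [← add_mul, hpq, one_mul]

theorem polar_re (r θ : ℝ) : ((r : ℂ) * Complex.exp (θ * Complex.I)).re = r * Real.cos θ := by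
  rw [Complex.re_ofReal_mul, Complex.exp_ofReal_mul_I_re]

theorem polar_im (r θ : ℝ) : ((r : ℂ) * Complex.exp (θ * Complex.I)).im = r * Real.sin θ := by
  rw [Complex.im_ofReal_mul, Complex.exp_ofReal_mul_I_im]

theorem polar_norm {r : ℝ} (hr : 0 ≤ r) (θ : ℝ) : ‖(r : ℂ) * Complex.exp (θ * Complex.I)‖ = r := by
  rw [norm_mul, Complex.norm_exp_ofReal_mul_I, mul_one, Complex.norm_of_nonneg hr]

theorem polar_mem_sec {b R r θ : ℝ} (hb : b ≤ Real.pi / 2) (hr : 0 ≤ r) (hrR : r ≤ R)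
    (hθ : |θ| ≤ b) : (r : ℂ) * Complex.exp (θ * Complex.I) ∈ sec b R := by
  rw [abs_le] at hθ
  refine ⟨?_, ?_, ?_⟩
  · rw [polar_re, polar_im]
    have : 0 ≤ Real.sin (b - θ) := Real.sin_nonneg_of_nonneg_of_le_pi (by linarith) (by linarith)
    rw [Real.sin_sub] at this
    have := mul_nonneg hr this
    linarith
  · rw [polar_re, polar_im]
    have : 0 ≤ Real.sin (b + θ) := Real.sin_nonneg_of_nonneg_of_le_pi (by linarith) (by linarith)
    rw [Real.sin_add] at this
    have := mul_nonneg hr this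
    linarith
  · rwa [polar_norm hr]

theorem polar_mem_osec {b R r θ : ℝ} (hb : b ≤ Real.pi / 2) (hr : 0 < r) (hrR : r < R)
    (hθ : |θ| < b) : (r : ℂ) * Complex.exp (θ * Complex.I) ∈ osec b R := by
  rw [abs_lt] at hθ
  refine ⟨?_, ?_, ?_⟩
  · rw [polar_re, polar_im]
    have : 0 < Real.sin (b - θ) := Real.sin_pos_of_pos_of_lt_pi (by linarith) (by linarith)
    rw [Real.sin_sub] at this
    have := mul_pos hr this
    linarith
  · rw [polar_re, polar_im]
    have : 0 < Real.sin (b + θ) := Real.sin_pos_of_pos_of_lt_pi (by linarith) (by linarith)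
    rw [Real.sin_add] at this
    have := mul_pos hr this
    linarith
  · rwa [polar_norm hr.le]

theorem exists_polar_osec {b R : ℝ} (hb0 : 0 < b) (hb : b ≤ Real.pi / 2) {w : ℂ}
    (hw : w ∈ osec b R) : ∃ r θ : ℝ, 0 < r ∧ r < R ∧ |θ| < b ∧
      w = (r : ℂ) * Complex.exp (θ * Complex.I) := by
  obtain ⟨h1, h2, h3⟩ := hw
  have hw0 : w ≠ 0 := by rintro rfl; simp at h1
  refine ⟨‖w‖, Complex.arg w, norm_pos_iff.2 hw0, h3, ?_, (Complex.norm_mul_exp_arg_mul_I w).symm⟩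
  have hr : 0 < ‖w‖ := norm_pos_iff.2 hw0
  rw [← Complex.norm_mul_exp_arg_mul_I w, polar_re, polar_im] at h1 h2
  have g1 : 0 < Real.sin (b - w.arg) := by
    rw [Real.sin_sub]
    refine pos_of_mul_pos_right (a := ‖w‖) ?_ hr.le
    linarith
  have g2 : 0 < Real.sin (b + w.arg) := by
    rw [Real.sin_add]
    refine pos_of_mul_pos_right (a := ‖w‖) ?_ hr.le
    linarith
  have a1 := Complex.arg_le_pi w
  have a2 := Complex.neg_pi_lt_arg w
  rw [abs_lt]
  constructor
  · by_contra hcon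
    have := Real.sin_nonpos_of_nonpos_of_neg_pi_le (x := b + w.arg) (by linarith) (by linarith)
    linarith
  · by_contra hcon
    have := Real.sin_nonpos_of_nonpos_of_neg_pi_le (x := b - w.arg) (by linarith) (by linarith)
    linarith

theorem exists_polar_sec {b R : ℝ} (hb0 : 0 < b) (hb : b ≤ Real.pi / 2) {w : ℂ}
    (hw : w ∈ sec b R) : ∃ r θ : ℝ, 0 ≤ r ∧ r ≤ R ∧ |θ| ≤ b ∧
      w = (r : ℂ) * Complex.exp (θ * Complex.I) := by
  obtain ⟨h1, h2, h3⟩ := hw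
  by_cases hw0 : w = 0
  · refine ⟨0, 0, le_rfl, ?_, by simpa using hb0.le, by simp [hw0]⟩
    simpa [hw0] using h3
  refine ⟨‖w‖, Complex.arg w, norm_nonneg _, h3, ?_, (Complex.norm_mul_exp_arg_mul_I w).symm⟩
  have hr : 0 < ‖w‖ := norm_pos_iff.2 hw0
  rw [← Complex.norm_mul_exp_arg_mul_I w, polar_re, polar_im] at h1 h2
  have g1 : 0 ≤ Real.sin (b - w.arg) := by
    rw [Real.sin_sub]
    refine nonneg_of_mul_nonneg_right (a := ‖w‖) ?_ hr
    linarith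
  have g2 : 0 ≤ Real.sin (b + w.arg) := by
    rw [Real.sin_add]
    refine nonneg_of_mul_nonneg_right (a := ‖w‖) ?_ hr
    linarith
  have a1 := Complex.arg_le_pi w
  have a2 := Complex.neg_pi_lt_arg w
  rw [abs_le]
  constructor
  · by_contra hcon
    have := Real.sin_neg_of_neg_of_neg_pi_lt (x := b + w.arg) (by linarith) (by linarith)
    linarith
  · by_contra hcon
    have := Real.sin_neg_of_neg_of_neg_pi_lt (x := b - w.arg) (by linarith) (by linarith)
    linarith

theorem polar_sq (r θ : ℝ) : ((r : ℂ) * Complex.exp (θ * Complex.I)) ^ 2 =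
    ((r ^ 2 : ℝ) : ℂ) * Complex.exp ((2 * θ : ℝ) * Complex.I) := by
  rw [mul_pow, ← Complex.exp_nat_mul]
  push_cast
  ring_nf

theorem sq_mem_sec {b R : ℝ} (hb0 : 0 < b) (hb : b ≤ Real.pi / 4) {w : ℂ}
    (hw : w ∈ sec b R) : w ^ 2 ∈ sec (2 * b) (R ^ 2) := by
  obtain ⟨r, θ, h1, h2, h3, rfl⟩ := exists_polar_sec hb0 (by linarith) hw
  rw [polar_sq]
  refine polar_mem_sec (by linarith) (by positivity) (by gcongr) ?_
  rw [abs_mul, abs_two]; linarith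

theorem exists_sq_osec {b R : ℝ} (hb0 : 0 < b) (hb : b ≤ Real.pi / 4) (hR : 0 < R) {z : ℂ}
    (hz : z ∈ osec (2 * b) (R ^ 2)) : ∃ w ∈ osec b R, w ^ 2 = z := by
  obtain ⟨r, θ, h1, h2, h3, rfl⟩ := exists_polar_osec (by linarith) (by linarith) hz
  refine ⟨(Real.sqrt r : ℝ) * Complex.exp ((θ / 2 : ℝ) * Complex.I), ?_, ?_⟩
  · refine polar_mem_osec (by linarith [Real.pi_pos]) (Real.sqrt_pos.2 h1) ?_ ?_
    · rw [Real.sqrt_lt' hR]; exact h2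
    · rw [abs_div, abs_two]; linarith
  · rw [polar_sq, Real.sq_sqrt h1.le]
    congr 4
    ring


/-- contour integral along the boundary of the sector -/
noncomputable def CI (b R : ℝ) (F : ℂ → ℂ) : ℂ :=
  (∫ t in (0 : ℝ)..R, F (t * Complex.exp ((-b : ℝ) * Complex.I)) * Complex.exp ((-b : ℝ) * Complex.I))
  + (∫ θ in (-b)..b, F (R * Complex.exp (θ * Complex.I)) * (R * Complex.I * Complex.exp (θ * Complex.I)))
  - ∫ t in (0 : ℝ)..R, F (t * Complex.exp (b * Complex.I)) * Complex.exp (b * Complex.I)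

theorem piece_ftc {s : Set ℂ} {F P : ℂ → ℂ} (hF : ContinuousOn F s)
    (hP : ∀ a ∈ s, HasDerivWithinAt P (F a) s a) {γ γ' : ℝ → ℂ} {x y : ℝ} (hxy : x ≤ y)
    (hγ : ∀ t, HasDerivAt γ (γ' t) t) (hγ' : Continuous γ') (hs : ∀ t ∈ Set.Icc x y, γ t ∈ s) :
    ∫ t in x..y, F (γ t) * γ' t = P (γ y) - P (γ x) := by
  have hγc : Continuous γ := continuous_iff_continuousAt.2 fun t => (hγ t).continuousAt
  have hd : ∀ t ∈ Set.Icc x y, HasDerivWithinAt (fun t => P (γ t)) (F (γ t) * γ' t) (Set.Icc x y) t := by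
    intro t ht
    exact (hP _ (hs t ht)).comp t (hγ t).hasDerivWithinAt hs
  refine intervalIntegral.integral_eq_sub_of_hasDerivAt_of_le hxy
    (f := fun t => P (γ t)) ?_ ?_ ?_
  · exact fun t ht => (hd t ht).continuousWithinAt
  · intro t ht
    exact (hd t ⟨ht.1.le, ht.2.le⟩).hasDerivAt (Icc_mem_nhds ht.1 ht.2)
  · apply ContinuousOn.intervalIntegrable
    rw [Set.uIcc_of_le hxy]
    exact (hF.comp hγc.continuousOn hs).mul hγ'.continuousOn

theorem hasDerivAt_ray (c : ℂ) (t : ℝ) : HasDerivAt (fun t : ℝ => (t : ℂ) * c) c t := by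
  simpa using (Complex.ofRealCLM.hasDerivAt (x := t)).mul_const c

theorem hasDerivAt_arc (R : ℝ) (t : ℝ) :
    HasDerivAt (fun θ : ℝ => (R : ℂ) * Complex.exp (θ * Complex.I))
      (R * Complex.I * Complex.exp (t * Complex.I)) t := by
  have h := ((hasDerivAt_ray Complex.I t).cexp).const_mul (R : ℂ)
  exact h.congr_deriv (by ring)

theorem lray_mem {b R : ℝ} (hb0 : 0 < b) (hb : b ≤ Real.pi / 2) {t : ℝ} (ht : t ∈ Set.Icc 0 R) :
    (t : ℂ) * Complex.exp ((-b : ℝ) * Complex.I) ∈ sec b R :=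
  polar_mem_sec hb ht.1 ht.2 (by rw [abs_neg, abs_of_pos hb0])

theorem uray_mem {b R : ℝ} (hb0 : 0 < b) (hb : b ≤ Real.pi / 2) {t : ℝ} (ht : t ∈ Set.Icc 0 R) :
    (t : ℂ) * Complex.exp (b * Complex.I) ∈ sec b R :=
  polar_mem_sec hb ht.1 ht.2 (by rw [abs_of_pos hb0])

theorem arc_mem {b R : ℝ} (hb : b ≤ Real.pi / 2) (hR : 0 < R) {t : ℝ} (ht : t ∈ Set.Icc (-b) b) :
    (R : ℂ) * Complex.exp (t * Complex.I) ∈ sec b R :=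
  polar_mem_sec hb hR.le le_rfl (abs_le.2 ht)

theorem CI_of_primitive {b R : ℝ} (hb0 : 0 < b) (hb : b ≤ Real.pi / 2) (hR : 0 < R)
    {F P : ℂ → ℂ} (hF : ContinuousOn F (sec b R))
    (hP : ∀ a ∈ sec b R, HasDerivWithinAt P (F a) (sec b R) a) : CI b R F = 0 := by
  unfold CI
  rw [piece_ftc hF hP hR.le (γ := fun t : ℝ => (t : ℂ) * Complex.exp ((-b : ℝ) * Complex.I))
      (γ' := fun _ => Complex.exp ((-b : ℝ) * Complex.I))
      (fun t => hasDerivAt_ray _ t) (by fun_prop) (fun t ht => lray_mem hb0 hb ht),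
    piece_ftc hF hP hR.le (γ := fun t : ℝ => (t : ℂ) * Complex.exp (b * Complex.I))
      (γ' := fun _ => Complex.exp (b * Complex.I))
      (fun t => hasDerivAt_ray _ t) (by fun_prop) (fun t ht => uray_mem hb0 hb ht),
    piece_ftc hF hP (by linarith) (γ := fun θ : ℝ => (R : ℂ) * Complex.exp (θ * Complex.I))
      (γ' := fun t => R * Complex.I * Complex.exp (t * Complex.I))
      (fun t => hasDerivAt_arc _ t) (by fun_prop) (fun t ht => arc_mem hb hR ht)]
  simp

theorem isCompact_sec (b R : ℝ) : IsCompact (sec b R) := by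
  have h1 : IsClosed {w : ℂ | 0 ≤ Real.sin b * w.re - Real.cos b * w.im} :=
    isClosed_le (by fun_prop) (by fun_prop)
  have h2 : IsClosed {w : ℂ | 0 ≤ Real.sin b * w.re + Real.cos b * w.im} :=
    isClosed_le (by fun_prop) (by fun_prop)
  have h3 : IsCompact (Metric.closedBall (0 : ℂ) R) := isCompact_closedBall _ _
  have : sec b R = {w : ℂ | 0 ≤ Real.sin b * w.re - Real.cos b * w.im} ∩
    ({w : ℂ | 0 ≤ Real.sin b * w.re + Real.cos b * w.im} ∩ Metric.closedBall (0 : ℂ) R) := by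
    ext w; simp [sec]
  rw [this]
  exact (h3.inter_left h2).inter_left h1

open Filter Topology in
theorem piece_tendsto {s : Set ℂ} {F : ℂ → ℂ} (Fn : ℕ → ℂ → ℂ) {M : ℝ}
    (hFn : ∀ n, ContinuousOn (Fn n) s) (hM : ∀ n, ∀ w ∈ s, ‖Fn n w‖ ≤ M)
    (hlim : ∀ w ∈ s, Tendsto (fun n => Fn n w) atTop (𝓝 (F w)))
    {γ γ' : ℝ → ℂ} {x y : ℝ} (hxy : x ≤ y)
    (hγ : Continuous γ) (hγ' : Continuous γ') (hs : ∀ t ∈ Set.Icc x y, γ t ∈ s) :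
    Tendsto (fun n => ∫ t in x..y, Fn n (γ t) * γ' t) atTop (𝓝 (∫ t in x..y, F (γ t) * γ' t)) := by
  apply intervalIntegral.tendsto_integral_filter_of_dominated_convergence (fun t => M * ‖γ' t‖)
  · refine Eventually.of_forall fun n => ?_
    have : IntervalIntegrable (fun t => Fn n (γ t) * γ' t) MeasureTheory.volume x y := by
      apply ContinuousOn.intervalIntegrable
      rw [Set.uIcc_of_le hxy]
      exact ((hFn n).comp hγ.continuousOn hs).mul hγ'.continuousOn
    exact (intervalIntegrable_iff.1 this).aestronglyMeasurable
  · refine Eventually.of_forall fun n => Eventually.of_forall fun t ht => ?_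
    rw [Set.uIoc_of_le hxy] at ht
    rw [norm_mul]
    gcongr
    exact hM n _ (hs t ⟨ht.1.le, ht.2⟩)
  · apply Continuous.intervalIntegrable
    fun_prop
  · refine Eventually.of_forall fun t ht => ?_
    rw [Set.uIoc_of_le hxy] at ht
    exact (hlim _ (hs t ⟨ht.1.le, ht.2⟩)).mul_const _

theorem half_mem_osec {b R : ℝ} (hb0 : 0 < b) (hb : b ≤ Real.pi / 2) (hR : 0 < R) :
    ((R / 2 : ℝ) : ℂ) ∈ osec b R := by
  have := polar_mem_osec (R := R) (r := R / 2) (θ := 0) hb (by linarith) (by linarith) (by simpa using hb0)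
  simpa using this

open Filter Topology in
theorem CI_eq_zero {b R : ℝ} (hb0 : 0 < b) (hb : b ≤ Real.pi / 2) (hR : 0 < R)
    {F : ℂ → ℂ} (hF : ContinuousOn F (sec b R)) (hd : DifferentiableOn ℂ F (osec b R)) :
    CI b R F = 0 := by
  set c : ℂ := ((R / 2 : ℝ) : ℂ) with hc
  have hcm : c ∈ osec b R := half_mem_osec hb0 hb hR
  let q : ℕ → ℝ := fun n => 1 / ((n : ℝ) + 1)
  have hq0 : ∀ n, 0 < q n := fun n => by positivity
  have hq1 : ∀ n, q n ≤ 1 := fun n => by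
    simp only [q]; rw [div_le_one (by positivity)]; linarith [Nat.cast_nonneg (α := ℝ) n]
  let Fn : ℕ → ℂ → ℂ := fun n w => F (((1 - q n : ℝ) : ℂ) * w + (q n : ℂ) * c)
  have hmap : ∀ n, ∀ w ∈ sec b R, ((1 - q n : ℝ) : ℂ) * w + (q n : ℂ) * c ∈ osec b R :=
    fun n w hw => comb_mem_osec hw hcm (by linarith [hq1 n]) (hq0 n) (by ring)
  have hFd : ∀ n, DifferentiableOn ℂ (Fn n) (sec b R) := fun n =>
    hd.comp (by fun_prop) (hmap n)
  have hzero : ∀ n, CI b R (Fn n) = 0 := by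
    intro n
    obtain ⟨P, hP⟩ := (convex_sec b R).exists_forall_hasDerivWithinAt (hFd n)
    exact CI_of_primitive hb0 hb hR (hFd n).continuousOn hP
  obtain ⟨M, hM⟩ := (isCompact_sec b R).exists_bound_of_continuousOn hF
  have hq : Tendsto q atTop (𝓝 0) := tendsto_one_div_add_atTop_nhds_zero_nat
  have hlim : ∀ w ∈ sec b R, Tendsto (fun n => Fn n w) atTop (𝓝 (F w)) := by
    intro w hw
    have h1 := hF w hw
    refine h1.tendsto.comp ?_
    rw [tendsto_nhdsWithin_iff]
    refine ⟨?_, Eventually.of_forall fun n => osec_subset_sec _ _ (hmap n w hw)⟩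
    have h2 : Tendsto (fun n => (q n : ℂ)) atTop (𝓝 ((0 : ℝ) : ℂ)) :=
      (Complex.continuous_ofReal.tendsto 0).comp hq
    have h3 : Tendsto (fun n => ((1 : ℂ) - q n) * w + (q n : ℂ) * c) atTop
      (𝓝 ((1 - ((0 : ℝ) : ℂ)) * w + ((0 : ℝ) : ℂ) * c)) :=
      ((h2.const_sub 1).mul_const w).add (h2.mul_const c)
    simpa using h3
  have hb' : ∀ n, ∀ w ∈ sec b R, ‖Fn n w‖ ≤ M := fun n w hw =>
    hM _ (osec_subset_sec _ _ (hmap n w hw))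
  have t1 := piece_tendsto Fn (fun n => (hFd n).continuousOn) hb' hlim hR.le
    (γ := fun t : ℝ => (t : ℂ) * Complex.exp ((-b : ℝ) * Complex.I))
    (γ' := fun _ => Complex.exp ((-b : ℝ) * Complex.I)) (by fun_prop) (by fun_prop)
    (fun t ht => lray_mem hb0 hb ht)
  have t2 := piece_tendsto Fn (fun n => (hFd n).continuousOn) hb' hlim hR.le
    (γ := fun t : ℝ => (t : ℂ) * Complex.exp (b * Complex.I))
    (γ' := fun _ => Complex.exp (b * Complex.I)) (by fun_prop) (by fun_prop)
    (fun t ht => uray_mem hb0 hb ht)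
  have t3 := piece_tendsto Fn (fun n => (hFd n).continuousOn) hb' hlim (show -b ≤ b by linarith)
    (γ := fun θ : ℝ => (R : ℂ) * Complex.exp (θ * Complex.I))
    (γ' := fun t => R * Complex.I * Complex.exp (t * Complex.I)) (by fun_prop) (by fun_prop)
    (fun t ht => arc_mem hb hR ht)
  have t4 : Tendsto (fun n => CI b R (Fn n)) atTop (𝓝 (CI b R F)) := (t1.add t3).sub t2
  simp only [hzero] at t4
  exact (tendsto_nhds_unique t4 tendsto_const_nhds)


theorem piece_log {γ γ' : ℝ → ℂ} {x y : ℝ} (hxy : x ≤ y)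
    (hγ : ∀ t, HasDerivAt γ (γ' t) t) (hγ' : Continuous γ')
    (hs : ∀ t ∈ Set.Icc x y, γ t ∈ Complex.slitPlane) :
    ∫ t in x..y, (γ t)⁻¹ * γ' t = Complex.log (γ y) - Complex.log (γ x) := by
  refine piece_ftc (s := Complex.slitPlane) (F := fun z => z⁻¹) (P := Complex.log) ?_ ?_ hxy hγ hγ' hs
  · exact continuousOn_inv₀.mono fun z hz => Complex.slitPlane_ne_zero hz
  · exact fun a ha => (Complex.hasDerivAt_log ha).hasDerivWithinAt

theorem log_neg_of_im_pos {u : ℂ} (h : 0 < u.im) : Complex.log (-u) = Complex.log u - Real.pi * Complex.I := by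
  rw [Complex.log, Complex.log, norm_neg, Complex.arg_neg_eq_arg_sub_pi_of_im_pos h]
  push_cast; ring

theorem log_neg_of_im_neg {u : ℂ} (h : u.im < 0) : Complex.log (-u) = Complex.log u + Real.pi * Complex.I := by
  rw [Complex.log, Complex.log, norm_neg, Complex.arg_neg_eq_arg_add_pi_of_im_neg h]
  push_cast; ring

theorem polar_div {r : ℝ} (t θ ψ : ℝ) :
    ((t : ℂ) * Complex.exp (θ * Complex.I)) / ((r : ℂ) * Complex.exp (ψ * Complex.I)) =
    ((t / r : ℝ) : ℂ) * Complex.exp ((θ - ψ : ℝ) * Complex.I) := by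
  rw [mul_div_mul_comm, ← Complex.exp_sub]
  push_cast
  rw [sub_mul]

theorem CI_inv {b R : ℝ} (hb0 : 0 < b) (hb : b ≤ Real.pi / 4) (hR : 0 < R) {w : ℂ}
    (hw : w ∈ osec b R) : CI b R (fun ω => (ω - w)⁻¹) = 2 * Real.pi * Complex.I := by
  obtain ⟨r, ψ, hr0, hrR, hψ, rfl⟩ := exists_polar_osec hb0 (by linarith) hw
  set w : ℂ := (r : ℂ) * Complex.exp (ψ * Complex.I) with hwdef
  have hpi := Real.pi_pos
  have hw0 : w ≠ 0 := by
    rw [← norm_pos_iff, hwdef, polar_norm hr0.le]; exact hr0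
  rw [abs_lt] at hψ
  -- lower ray
  have im_low : ∀ t : ℝ, 0 < t → ((t : ℂ) * Complex.exp ((-b : ℝ) * Complex.I) / w - 1).im < 0 := by
    intro t ht
    rw [hwdef, polar_div, Complex.sub_im, polar_im, Complex.one_im, sub_zero]
    refine mul_neg_of_pos_of_neg (by positivity) ?_
    exact Real.sin_neg_of_neg_of_neg_pi_lt (by linarith) (by linarith)
  have im_up : ∀ t : ℝ, 0 < t → 0 < ((t : ℂ) * Complex.exp (b * Complex.I) / w - 1).im := by
    intro t ht
    rw [hwdef, polar_div, Complex.sub_im, polar_im, Complex.one_im, sub_zero]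
    refine mul_pos (by positivity) ?_
    exact Real.sin_pos_of_pos_of_lt_pi (by linarith) (by linarith)
  have key : ∀ (ω d : ℂ), (ω - w)⁻¹ * d = (ω / w - 1)⁻¹ * (d / w) := by
    intro ω d
    rw [show ω / w - 1 = (ω - w) / w by field_simp, inv_div]
    field_simp
  have key2 : ∀ (ω d : ℂ), (ω - w)⁻¹ * d = (-(ω / w - 1))⁻¹ * (-(d / w)) := by
    intro ω d
    rw [key, inv_neg, neg_mul_neg]
  have hder : ∀ {γ γ' : ℝ → ℂ}, (∀ t, HasDerivAt γ (γ' t) t) →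
      ∀ t, HasDerivAt (fun t => γ t / w - 1) (γ' t / w) t :=
    fun h t => ((h t).div_const w).sub_const 1
  have i1 : (∫ t in (0 : ℝ)..R, ((t : ℂ) * Complex.exp ((-b : ℝ) * Complex.I) - w)⁻¹ * Complex.exp ((-b : ℝ) * Complex.I))
      = Complex.log (-((R : ℂ) * Complex.exp ((-b : ℝ) * Complex.I) / w - 1)) := by
    simp_rw [key2]
    rw [piece_log (γ := fun t : ℝ => -((t : ℂ) * Complex.exp ((-b : ℝ) * Complex.I) / w - 1))
      (γ' := fun _ => -(Complex.exp ((-b : ℝ) * Complex.I) / w)) hR.le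
      (fun t => (hder (fun t => hasDerivAt_ray _ t) t).neg) (by fun_prop)]
    · simp
    · intro t ht
      rcases ht.1.eq_or_lt with h | h
      · rw [← h]; simp
      · right
        rw [Complex.neg_im]
        have := im_low t h
        linarith
  have i2 : (∫ t in (0 : ℝ)..R, ((t : ℂ) * Complex.exp (b * Complex.I) - w)⁻¹ * Complex.exp (b * Complex.I))
      = Complex.log (-((R : ℂ) * Complex.exp (b * Complex.I) / w - 1)) := by
    simp_rw [key2]
    rw [piece_log (γ := fun t : ℝ => -((t : ℂ) * Complex.exp (b * Complex.I) / w - 1))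
      (γ' := fun _ => -(Complex.exp (b * Complex.I) / w)) hR.le
      (fun t => (hder (fun t => hasDerivAt_ray _ t) t).neg) (by fun_prop)]
    · simp
    · intro t ht
      rcases ht.1.eq_or_lt with h | h
      · rw [← h]; simp
      · right
        rw [Complex.neg_im]
        have := im_up t h
        linarith
  have i3 : (∫ θ in (-b)..b, ((R : ℂ) * Complex.exp (θ * Complex.I) - w)⁻¹ * (R * Complex.I * Complex.exp (θ * Complex.I)))
      = Complex.log ((R : ℂ) * Complex.exp (b * Complex.I) / w - 1)
        - Complex.log ((R : ℂ) * Complex.exp ((-b : ℝ) * Complex.I) / w - 1) := by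
    simp_rw [key]
    rw [piece_log (γ := fun t : ℝ => ((R : ℂ) * Complex.exp (t * Complex.I) / w - 1))
      (γ' := fun t => (R * Complex.I * Complex.exp (t * Complex.I)) / w) (by linarith)
      (fun t => (hder (fun t => hasDerivAt_arc _ t) t)) (by fun_prop)]
    intro t ht
    obtain ⟨ht1, ht2⟩ := ht
    rcases lt_trichotomy t ψ with h | h | h
    · right
      rw [hwdef, polar_div, Complex.sub_im, polar_im, Complex.one_im, sub_zero]
      refine (mul_neg_of_pos_of_neg (by positivity) ?_).ne
      exact Real.sin_neg_of_neg_of_neg_pi_lt (by linarith) (by linarith)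
    · left
      rw [hwdef, polar_div, Complex.sub_re, polar_re, h, sub_self, Real.cos_zero, mul_one, Complex.one_re]
      have : 1 < R / r := by rwa [one_lt_div hr0]
      linarith
    · right
      rw [hwdef, polar_div, Complex.sub_im, polar_im, Complex.one_im, sub_zero]
      refine (mul_pos (by positivity) ?_).ne'
      exact Real.sin_pos_of_pos_of_lt_pi (by linarith) (by linarith)
  unfold CI
  rw [i1, i2, i3, log_neg_of_im_neg (im_low R hR), log_neg_of_im_pos (im_up R hR)]
  ring

theorem piece_int {s : Set ℂ} {F : ℂ → ℂ} (hF : ContinuousOn F s) {γ γ' : ℝ → ℂ} {x y : ℝ}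
    (hxy : x ≤ y) (hγ : Continuous γ) (hγ' : Continuous γ') (hs : ∀ t ∈ Set.Icc x y, γ t ∈ s) :
    IntervalIntegrable (fun t => F (γ t) * γ' t) MeasureTheory.volume x y := by
  apply ContinuousOn.intervalIntegrable
  rw [Set.uIcc_of_le hxy]
  exact (hF.comp hγ.continuousOn hs).mul hγ'.continuousOn

/-- the part of the sector traversed by the contour -/
def bd (b R : ℝ) : Set ℂ :=
  sec b R \ osec b R

theorem osec_of_eq {b R : ℝ} (w : ℂ) (h : w ∈ osec b R) :
    0 < Real.sin b * w.re - Real.cos b * w.im ∧ 0 < Real.sin b * w.re + Real.cos b * w.im ∧ ‖w‖ < R := h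

theorem lray_bd {b R : ℝ} (hb0 : 0 < b) (hb : b ≤ Real.pi / 2) {t : ℝ} (ht : t ∈ Set.Icc 0 R) :
    (t : ℂ) * Complex.exp ((-b : ℝ) * Complex.I) ∈ bd b R := by
  refine ⟨lray_mem hb0 hb ht, fun h => ?_⟩
  have := h.2.1
  rw [polar_re, polar_im, Real.sin_neg, Real.cos_neg] at this
  linarith

theorem uray_bd {b R : ℝ} (hb0 : 0 < b) (hb : b ≤ Real.pi / 2) {t : ℝ} (ht : t ∈ Set.Icc 0 R) :
    (t : ℂ) * Complex.exp (b * Complex.I) ∈ bd b R := by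
  refine ⟨uray_mem hb0 hb ht, fun h => ?_⟩
  have := h.1
  rw [polar_re, polar_im] at this
  linarith

theorem arc_bd {b R : ℝ} (hb : b ≤ Real.pi / 2) (hR : 0 < R) {t : ℝ} (ht : t ∈ Set.Icc (-b) b) :
    (R : ℂ) * Complex.exp (t * Complex.I) ∈ bd b R := by
  refine ⟨arc_mem hb hR ht, fun h => ?_⟩
  have := h.2.2
  rw [polar_norm hR.le] at this
  linarith

theorem CI_add {b R : ℝ} (hb0 : 0 < b) (hb : b ≤ Real.pi / 2) (hR : 0 < R) {F G : ℂ → ℂ}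
    (hF : ContinuousOn F (bd b R)) (hG : ContinuousOn G (bd b R)) :
    CI b R (fun w => F w + G w) = CI b R F + CI b R G := by
  unfold CI
  simp_rw [add_mul]
  rw [intervalIntegral.integral_add, intervalIntegral.integral_add, intervalIntegral.integral_add]
  · ring
  · exact piece_int hF hR.le (γ := fun t : ℝ => (t : ℂ) * Complex.exp (b * Complex.I))
      (γ' := fun _ => Complex.exp (b * Complex.I))
      (by fun_prop) (by fun_prop) (fun t ht => uray_bd hb0 hb ht)
  · exact piece_int hG hR.le (γ := fun t : ℝ => (t : ℂ) * Complex.exp (b * Complex.I))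
      (γ' := fun _ => Complex.exp (b * Complex.I))
      (by fun_prop) (by fun_prop) (fun t ht => uray_bd hb0 hb ht)
  · exact piece_int hF (by linarith) (γ := fun θ : ℝ => (R : ℂ) * Complex.exp (θ * Complex.I))
      (γ' := fun t => R * Complex.I * Complex.exp (t * Complex.I)) (by fun_prop) (by fun_prop)
      (fun t ht => arc_bd hb hR ht)
  · exact piece_int hG (by linarith) (γ := fun θ : ℝ => (R : ℂ) * Complex.exp (θ * Complex.I))
      (γ' := fun t => R * Complex.I * Complex.exp (t * Complex.I)) (by fun_prop) (by fun_prop)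
      (fun t ht => arc_bd hb hR ht)
  · exact piece_int hF hR.le (γ := fun t : ℝ => (t : ℂ) * Complex.exp ((-b : ℝ) * Complex.I))
      (γ' := fun _ => Complex.exp ((-b : ℝ) * Complex.I))
      (by fun_prop) (by fun_prop) (fun t ht => lray_bd hb0 hb ht)
  · exact piece_int hG hR.le (γ := fun t : ℝ => (t : ℂ) * Complex.exp ((-b : ℝ) * Complex.I))
      (γ' := fun _ => Complex.exp ((-b : ℝ) * Complex.I))
      (by fun_prop) (by fun_prop) (fun t ht => lray_bd hb0 hb ht)

theorem CI_congr {b R : ℝ} (hb0 : 0 < b) (hb : b ≤ Real.pi / 2) (hR : 0 < R) {F G : ℂ → ℂ}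
    (h : ∀ w ∈ bd b R, F w = G w) : CI b R F = CI b R G := by
  unfold CI
  congr 1
  · congr 1
    · refine intervalIntegral.integral_congr fun t ht => ?_
      rw [Set.uIcc_of_le hR.le] at ht
      simp only [h _ (lray_bd hb0 hb ht)]
    · refine intervalIntegral.integral_congr fun t ht => ?_
      rw [Set.uIcc_of_le (by linarith)] at ht
      simp only [h _ (arc_bd hb hR ht)]
  · refine intervalIntegral.integral_congr fun t ht => ?_
    rw [Set.uIcc_of_le hR.le] at ht
    simp only [h _ (uray_bd hb0 hb ht)]

theorem CI_const_mul {b R : ℝ} (c : ℂ) (F : ℂ → ℂ) :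
    CI b R (fun w => c * F w) = c * CI b R F := by
  unfold CI
  simp_rw [mul_assoc, intervalIntegral.integral_const_mul]
  ring

theorem sec_re_nonneg {b R : ℝ} (hb0 : 0 < b) (hb : b ≤ Real.pi / 2) {w : ℂ} (hw : w ∈ sec b R) :
    0 ≤ w.re := by
  have h1 := hw.1
  have h2 := hw.2.1
  have : 0 < Real.sin b := Real.sin_pos_of_pos_of_lt_pi hb0 (by linarith)
  nlinarith

theorem osec_re_pos {b R : ℝ} (hb0 : 0 < b) (hb : b ≤ Real.pi / 2) {w : ℂ} (hw : w ∈ osec b R) :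
    0 < w.re := by
  have h1 := hw.1
  have h2 := hw.2.1
  have : 0 < Real.sin b := Real.sin_pos_of_pos_of_lt_pi hb0 (by linarith)
  nlinarith

theorem cauchy_sector {b R : ℝ} (hb0 : 0 < b) (hb : b ≤ Real.pi / 4) (hR : 0 < R) {g : ℂ → ℂ}
    (hg : ContinuousOn g (sec b R)) (hd : DifferentiableOn ℂ g (osec b R)) {w : ℂ}
    (hw : w ∈ osec b R) :
    CI b R (fun ω => g ω * (2 * ω) / (ω ^ 2 - w ^ 2)) = 2 * Real.pi * Complex.I * g w := by
  have hpi := Real.pi_pos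
  have hb2 : b ≤ Real.pi / 2 := by linarith
  have hplus : ∀ ω ∈ sec b R, ω + w ≠ 0 := by
    intro ω hω h0
    have h1 := sec_re_nonneg hb0 hb2 hω
    have h2 := osec_re_pos hb0 hb2 hw
    have := congrArg Complex.re h0
    simp at this
    linarith
  have hminus : ∀ ω ∈ bd b R, ω - w ≠ 0 := by
    intro ω hω h0
    rw [sub_eq_zero] at h0
    exact hω.2 (h0 ▸ hw)
  have hbds : bd b R ⊆ sec b R := Set.sdiff_subset
  have hnhds : osec b R ∈ nhds w := (isOpen_osec b R).mem_nhds hw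
  have hnhds' : sec b R ∈ nhds w := Filter.mem_of_superset hnhds (osec_subset_sec b R)
  have c1 : ContinuousOn (fun ω => g ω / (ω + w)) (sec b R) :=
    hg.div (by fun_prop) hplus
  have z1 : CI b R (fun ω => g ω / (ω + w)) = 0 :=
    CI_eq_zero hb0 hb2 hR c1
      (hd.div (by fun_prop) fun ω hω => hplus ω (osec_subset_sec b R hω))
  have c2 : ContinuousOn (dslope g w) (sec b R) :=
    (continuousOn_dslope hnhds').2 ⟨hg, hd.differentiableAt hnhds⟩
  have z2 : CI b R (dslope g w) = 0 :=
    CI_eq_zero hb0 hb2 hR c2 ((Complex.differentiableOn_dslope hnhds).2 hd)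
  have c3 : ContinuousOn (fun ω => g w * (ω - w)⁻¹) (bd b R) :=
    continuousOn_const.mul (ContinuousOn.inv₀ (by fun_prop) hminus)
  have e1 : CI b R (fun ω => g ω * (2 * ω) / (ω ^ 2 - w ^ 2)) =
      CI b R (fun ω => (g ω / (ω + w) + dslope g w ω) + g w * (ω - w)⁻¹) := by
    refine CI_congr hb0 hb2 hR fun ω hω => ?_
    have h1 := hplus ω (hbds hω)
    have h2 := hminus ω hω
    have h3 : ω ≠ w := sub_ne_zero.1 h2
    rw [dslope_of_ne _ h3, slope_def_field]
    have : ω ^ 2 - w ^ 2 ≠ 0 := by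
      rw [sq_sub_sq]; exact mul_ne_zero h1 h2
    field_simp
    ring
  rw [e1, CI_add hb0 hb2 hR (F := fun ω => g ω / (ω + w) + dslope g w ω)
    ((c1.mono hbds).add (c2.mono hbds)) c3,
    CI_add hb0 hb2 hR (c1.mono hbds) (c2.mono hbds), z1, z2, CI_const_mul, CI_inv hb0 hb hR hw]
  ring


/-- Taylor polynomial of exp -/
noncomputable def Qt (M : ℕ) (x : ℂ) : ℂ := ∑ i ∈ Finset.range M, x ^ i / (i.factorial : ℂ)

theorem real_exp_hasSum (r : ℝ) : HasSum (fun i : ℕ => r ^ i / (i.factorial : ℝ)) (Real.exp r) := by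
  have := NormedSpace.expSeries_div_hasSum_exp (𝔸 := ℝ) r
  rwa [← Real.exp_eq_exp_ℝ] at this

theorem complex_exp_hasSum (r : ℂ) : HasSum (fun i : ℕ => r ^ i / (i.factorial : ℂ)) (Complex.exp r) := by
  have := NormedSpace.expSeries_div_hasSum_exp (𝔸 := ℂ) r
  rwa [← Complex.exp_eq_exp_ℂ] at this

theorem Qt_tail (M : ℕ) (x : ℂ) : ‖Complex.exp x - Qt M x‖ ≤ Real.exp (-M + 3 * ‖x‖) := by
  have h1 : HasSum (fun i : ℕ => x ^ (i + M) / ((i + M).factorial : ℂ)) (Complex.exp x - Qt M x) :=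
    (hasSum_nat_add_iff' M).2 (complex_exp_hasSum x)
  have h2 := (real_exp_hasSum (Real.exp 1 * ‖x‖))
  have h3 : Summable (fun i : ℕ => (Real.exp 1 * ‖x‖) ^ (i + M) / ((i + M).factorial : ℝ)) :=
    (summable_nat_add_iff M).2 h2.summable
  have h4 : ∑' i : ℕ, (Real.exp 1 * ‖x‖) ^ (i + M) / ((i + M).factorial : ℝ) ≤ Real.exp (Real.exp 1 * ‖x‖) := by
    rw [← h2.tsum_eq, ← h2.summable.sum_add_tsum_nat_add M]
    have : 0 ≤ ∑ i ∈ Finset.range M, (Real.exp 1 * ‖x‖) ^ i / (i.factorial : ℝ) :=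
      Finset.sum_nonneg fun i _ => by positivity
    linarith
  have h5 : ∀ i : ℕ, ‖x ^ (i + M) / ((i + M).factorial : ℂ)‖ ≤
      Real.exp (-M) * ((Real.exp 1 * ‖x‖) ^ (i + M) / ((i + M).factorial : ℝ)) := by
    intro i
    rw [norm_div, norm_pow, Complex.norm_natCast, mul_pow, ← Real.exp_nat_mul, mul_one]
    rw [← mul_div_assoc, ← mul_assoc, ← Real.exp_add]
    gcongr
    have : (1 : ℝ) ≤ Real.exp (-M + (i + M : ℕ)) := by
      rw [Real.one_le_exp_iff]; push_cast; linarith [Nat.cast_nonneg (α := ℝ) i]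
    exact le_mul_of_one_le_left (by positivity) this
  have h6 : ‖Complex.exp x - Qt M x‖ ≤ Real.exp (-M) * ∑' i : ℕ, (Real.exp 1 * ‖x‖) ^ (i + M) / ((i + M).factorial : ℝ) := by
    rw [← h1.tsum_eq]
    exact tsum_of_norm_bounded (h3.hasSum.mul_left _) h5
  calc _ ≤ _ := h6
    _ ≤ Real.exp (-M) * Real.exp (Real.exp 1 * ‖x‖) := by gcongr
    _ = Real.exp (-M + Real.exp 1 * ‖x‖) := by rw [Real.exp_add]
    _ ≤ _ := by
      gcongr
      exact (Real.exp_one_lt_d9.trans (by norm_num)).le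

/-- polynomial kernel -/
noncomputable def kk (M : ℕ) (u : ℂ) : ℂ :=
  ∑ j ∈ Finset.range M, ((-1) ^ j * (2 ^ (j + 2) - 1) / ((j + 2).factorial : ℂ)) * u ^ j

theorem kk_identity (M : ℕ) (u : ℂ) :
    u ^ 2 * kk M u = u + Qt (M + 2) (-2 * u) - Qt (M + 2) (-u) := by
  unfold kk Qt
  rw [add_sub_assoc, ← Finset.sum_sub_distrib, Finset.sum_range_succ', Finset.sum_range_succ', Finset.mul_sum]
  have : ∀ j ∈ Finset.range M, (-2 * u) ^ (j + 1 + 1) / ((j + 1 + 1).factorial : ℂ) - (-u) ^ (j + 1 + 1) / ((j + 1 + 1).factorial : ℂ)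
    = u ^ 2 * (((-1) ^ j * (2 ^ (j + 2) - 1) / ((j + 2).factorial : ℂ)) * u ^ j) := by
    intro j _
    have e1 : (-2 * u) ^ (j + 1 + 1) = (-1) ^ j * 2 ^ (j + 2) * u ^ 2 * u ^ j := by
      rw [show -2 * u = (-1) * (2 * u) by ring, mul_pow, mul_pow]; ring
    have e2 : (-u) ^ (j + 1 + 1) = (-1) ^ j * u ^ 2 * u ^ j := by
      rw [neg_pow u]; ring
    rw [e1, e2]
    ring
  rw [Finset.sum_congr rfl this]
  simp
  ring

theorem kk_small (M : ℕ) {u : ℂ} (hu : ‖u‖ ≤ 1) : ‖kk M u‖ ≤ 8 := by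
  unfold kk
  have hs := real_exp_hasSum 2
  have hb : ∀ j ∈ Finset.range M, ‖((-1) ^ j * (2 ^ (j + 2) - 1) / ((j + 2).factorial : ℂ)) * u ^ j‖ ≤
     (2 : ℝ) ^ (j + 2) / ((j + 2).factorial : ℝ) := by
    intro j _
    rw [norm_mul, norm_div, norm_mul, norm_pow, norm_pow, norm_neg, norm_one, one_pow, one_mul, Complex.norm_natCast]
    have h1 : ‖(2 : ℂ) ^ (j + 2) - 1‖ ≤ 2 ^ (j + 2) := by
      have : (2 : ℂ) ^ (j + 2) - 1 = ((2 ^ (j + 2) - 1 : ℝ) : ℂ) := by push_cast; ring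
      rw [this, Complex.norm_of_nonneg]
      · linarith
      · have : (1 : ℝ) ≤ 2 ^ (j + 2) := one_le_pow₀ (by norm_num)
        linarith
    have h2 : ‖u‖ ^ j ≤ 1 := pow_le_one₀ (norm_nonneg _) hu
    calc _ ≤ (2 : ℝ) ^ (j + 2) / ((j + 2).factorial : ℝ) * 1 := by gcongr
      _ = _ := mul_one _
  calc _ ≤ ∑ j ∈ Finset.range M, (2 : ℝ) ^ (j + 2) / ((j + 2).factorial : ℝ) := norm_sum_le_of_le _ hb
    _ ≤ ∑ j ∈ Finset.range (M + 2), (2 : ℝ) ^ j / (j.factorial : ℝ) := by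
      rw [Finset.sum_range_succ', Finset.sum_range_succ']
      simp only [add_assoc]
      norm_num
    _ ≤ Real.exp 2 := sum_le_hasSum _ (fun i _ => by positivity) hs
    _ ≤ 8 := by
      have := Real.exp_one_lt_d9
      have h0 := Real.exp_pos 1
      rw [show (2 : ℝ) = 1 + 1 by norm_num, Real.exp_add]
      nlinarith

theorem kk_large {M : ℕ} {u : ℂ} (h1 : 1 ≤ ‖u‖) (hM : ‖u‖ ≤ M / 12) (hre : 0 ≤ u.re) :
    ‖kk M u - u⁻¹‖ ≤ 4 * Real.exp (-u.re) / ‖u‖ ^ 2 := by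
  have hu : u ≠ 0 := by rw [← norm_pos_iff]; linarith
  have hid := kk_identity M u
  have t1 := Qt_tail (M + 2) (-2 * u)
  have t2 := Qt_tail (M + 2) (-u)
  have hr := Complex.re_le_norm u
  rw [norm_mul, norm_neg, Complex.norm_two] at t1
  rw [norm_neg] at t2
  push_cast at t1 t2
  have b1 : ‖Complex.exp (-2 * u) - Qt (M + 2) (-2 * u)‖ ≤ Real.exp (-u.re) :=
    t1.trans (Real.exp_le_exp.2 (by linarith))
  have b2 : ‖Complex.exp (-u) - Qt (M + 2) (-u)‖ ≤ Real.exp (-u.re) :=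
    t2.trans (Real.exp_le_exp.2 (by linarith))
  have b3 : ‖Complex.exp (-2 * u)‖ ≤ Real.exp (-u.re) := by
    rw [Complex.norm_exp]; apply Real.exp_le_exp.2; simp; linarith
  have b4 : ‖Complex.exp (-u)‖ ≤ Real.exp (-u.re) := by
    rw [Complex.norm_exp]; simp
  have e : kk M u - u⁻¹ = (Complex.exp (-2 * u) - (Complex.exp (-2 * u) - Qt (M + 2) (-2 * u))
      - Complex.exp (-u) + (Complex.exp (-u) - Qt (M + 2) (-u))) / u ^ 2 := by
    rw [eq_div_iff (pow_ne_zero 2 hu)]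
    have h9 : u⁻¹ * u ^ 2 = u := by field_simp
    linear_combination hid - h9
  rw [e, norm_div, norm_pow]
  gcongr
  calc _ ≤ ‖Complex.exp (-2 * u) - (Complex.exp (-2 * u) - Qt (M + 2) (-2 * u)) - Complex.exp (-u)‖ + ‖(Complex.exp (-u) - Qt (M + 2) (-u))‖ := norm_add_le _ _
    _ ≤ ‖Complex.exp (-2 * u) - (Complex.exp (-2 * u) - Qt (M + 2) (-2 * u))‖ + ‖Complex.exp (-u)‖ + ‖(Complex.exp (-u) - Qt (M + 2) (-u))‖ := by gcongr; exact norm_sub_le _ _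
    _ ≤ ‖Complex.exp (-2 * u)‖ + ‖(Complex.exp (-2 * u) - Qt (M + 2) (-2 * u))‖ + ‖Complex.exp (-u)‖ + ‖(Complex.exp (-u) - Qt (M + 2) (-u))‖ := by gcongr; exact norm_sub_le _ _
    _ ≤ _ := by linarith

theorem kk_bound {M : ℕ} {u : ℂ} (hM : ‖u‖ ≤ M / 12) (hre : 0 ≤ u.re) : ‖kk M u‖ ≤ 8 := by
  rcases le_total ‖u‖ 1 with h | h
  · exact kk_small M h
  · have h1 := kk_large h hM hre
    have h2 : 4 * Real.exp (-u.re) / ‖u‖ ^ 2 ≤ 4 := by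
      rw [div_le_iff₀ (by positivity)]
      have : Real.exp (-u.re) ≤ 1 := Real.exp_le_one_iff.2 (by linarith)
      nlinarith
    have h3 : ‖u⁻¹‖ ≤ 1 := by rw [norm_inv]; exact inv_le_one_of_one_le₀ h
    calc ‖kk M u‖ = ‖(kk M u - u⁻¹) + u⁻¹‖ := by rw [sub_add_cancel]
      _ ≤ _ := norm_add_le _ _
      _ ≤ 8 := by linarith

theorem kk_shift {D : ℝ} (hD : 0 ≤ D) : ∃ C : ℝ, 0 < C ∧ ∀ (M : ℕ) (u u' : ℂ), ‖u‖ ≤ M / 12 → ‖u'‖ ≤ M / 12 →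
    0 ≤ u.re → 0 ≤ u'.re → ‖u - u'‖ ≤ D → ‖kk M u - kk M u'‖ ≤ C / (1 + ‖u‖ ^ 2) := by
  refine ⟨16 * (1 + (2 * D + 2) ^ 2) + 2 * (2 * D + 20), by positivity, ?_⟩
  intro M u u' hu hu' hr hr' hd
  have hpos : 0 < 1 + ‖u‖ ^ 2 := by positivity
  rw [le_div_iff₀ hpos]
  rcases le_total ‖u‖ (2 * D + 2) with h | h
  · have h1 : ‖kk M u - kk M u'‖ ≤ 16 := by
      calc _ ≤ ‖kk M u‖ + ‖kk M u'‖ := norm_sub_le _ _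
        _ ≤ 16 := by linarith [kk_bound hu hr, kk_bound hu' hr']
    have h2 : ‖u‖ ^ 2 ≤ (2 * D + 2) ^ 2 := by gcongr
    calc _ ≤ 16 * (1 + (2 * D + 2) ^ 2) := by gcongr
      _ ≤ _ := by linarith
  · have hu'2 : ‖u‖ / 2 ≤ ‖u'‖ := by
      have := norm_sub_norm_le u u'
      linarith
    have k1 := kk_large (by linarith) hu hr
    have k2 := kk_large (u := u') (by linarith) hu' hr'
    have x1 : Real.exp (-u.re) ≤ 1 := Real.exp_le_one_iff.2 (by linarith)
    have x2 : Real.exp (-u'.re) ≤ 1 := Real.exp_le_one_iff.2 (by linarith)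
    have pu : 0 < ‖u‖ := by linarith
    have pu' : 0 < ‖u'‖ := by linarith
    have k1' : ‖kk M u - u⁻¹‖ ≤ 4 / ‖u‖ ^ 2 := k1.trans (by gcongr; linarith)
    have k2' : ‖kk M u' - u'⁻¹‖ ≤ 16 / ‖u‖ ^ 2 := by
      refine k2.trans ?_
      rw [div_le_div_iff₀ (by positivity) (by positivity)]
      have : ‖u‖ ^ 2 / 4 ≤ ‖u'‖ ^ 2 := by nlinarith
      nlinarith [Real.exp_pos (-u'.re)]
    have k3 : ‖u⁻¹ - u'⁻¹‖ ≤ 2 * D / ‖u‖ ^ 2 := by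
      rw [inv_sub_inv (norm_pos_iff.1 pu) (norm_pos_iff.1 pu'), norm_div, norm_mul, norm_sub_rev]
      rw [div_le_div_iff₀ (by positivity) (by positivity)]
      have : ‖u - u'‖ * ‖u‖ ^ 2 ≤ D * ‖u‖ ^ 2 := by gcongr
      have : ‖u‖ * (‖u‖ / 2) ≤ ‖u‖ * ‖u'‖ := by gcongr
      nlinarith
    have k4 : ‖kk M u - kk M u'‖ ≤ (2 * D + 20) / ‖u‖ ^ 2 := by
      have : kk M u - kk M u' = (kk M u - u⁻¹) + (u⁻¹ - u'⁻¹) - (kk M u' - u'⁻¹) := by ring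
      rw [this]
      calc _ ≤ ‖(kk M u - u⁻¹) + (u⁻¹ - u'⁻¹)‖ + ‖kk M u' - u'⁻¹‖ := norm_sub_le _ _
        _ ≤ ‖kk M u - u⁻¹‖ + ‖u⁻¹ - u'⁻¹‖ + ‖kk M u' - u'⁻¹‖ := by gcongr; exact norm_add_le _ _
        _ ≤ 4 / ‖u‖ ^ 2 + 2 * D / ‖u‖ ^ 2 + 16 / ‖u‖ ^ 2 := by gcongr
        _ = _ := by ring
    have k5 : 1 + ‖u‖ ^ 2 ≤ 2 * ‖u‖ ^ 2 := by nlinarith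
    calc _ ≤ (2 * D + 20) / ‖u‖ ^ 2 * (2 * ‖u‖ ^ 2) := by gcongr
      _ = 2 * (2 * D + 20) := by field_simp
      _ ≤ _ := by nlinarith [sq_nonneg (2 * D + 2)]

theorem kk_mid {r : ℝ} (hr0 : 0 < r) : ∃ C : ℝ, 0 < C ∧ ∀ (M : ℕ) (u : ℂ), ‖u‖ ≤ M / 12 →
    r ≤ u.re → ‖kk M u - u⁻¹‖ ≤ C / (1 + ‖u‖ ^ 2) := by
  refine ⟨2 * (8 + 1 / r), by positivity, ?_⟩
  intro M u hu hr
  have hpos : 0 < 1 + ‖u‖ ^ 2 := by positivity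
  have hn := Complex.re_le_norm u
  have hr1 : 0 < 1 / r := by positivity
  rw [le_div_iff₀ hpos]
  rcases le_total ‖u‖ 1 with h | h
  · have h3 : ‖u⁻¹‖ ≤ 1 / r := by
      rw [norm_inv, ← one_div]; exact one_div_le_one_div_of_le hr0 (by linarith)
    have h1 : ‖kk M u - u⁻¹‖ ≤ 8 + 1 / r := by
      calc _ ≤ ‖kk M u‖ + ‖u⁻¹‖ := norm_sub_le _ _
        _ ≤ _ := by linarith [kk_small M h]
    have h2 : 1 + ‖u‖ ^ 2 ≤ 2 := by nlinarith [norm_nonneg u]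
    calc _ ≤ (8 + 1 / r) * 2 := by gcongr
      _ = _ := by ring
  · have k1 := kk_large h hu (by linarith)
    have x1 : Real.exp (-u.re) ≤ 1 := Real.exp_le_one_iff.2 (by linarith)
    have k1' : ‖kk M u - u⁻¹‖ ≤ 4 / ‖u‖ ^ 2 := k1.trans (by gcongr; linarith)
    have k5 : 1 + ‖u‖ ^ 2 ≤ 2 * ‖u‖ ^ 2 := by nlinarith
    calc _ ≤ 4 / ‖u‖ ^ 2 * (2 * ‖u‖ ^ 2) := by gcongr
      _ = 8 := by field_simp; norm_num
      _ ≤ _ := by linarith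

theorem kk_exp {M : ℕ} {u : ℂ} {d : ℝ} (hM : ‖u‖ ≤ M / 12) (h1 : 1 ≤ d) (hd : d ≤ u.re) :
    ‖kk M u - u⁻¹‖ ≤ 8 * Real.exp (-d) / (1 + ‖u‖ ^ 2) := by
  have hn := Complex.re_le_norm u
  have h : 1 ≤ ‖u‖ := by linarith
  refine (kk_large h hM (by linarith)).trans ?_
  rw [div_le_div_iff₀ (by positivity) (by positivity)]
  have x1 : Real.exp (-u.re) ≤ Real.exp (-d) := Real.exp_le_exp.2 (by linarith)
  have k5 : 1 + ‖u‖ ^ 2 ≤ 2 * ‖u‖ ^ 2 := by nlinarith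
  calc _ ≤ 4 * Real.exp (-d) * (2 * ‖u‖ ^ 2) := by gcongr
    _ = _ := by ring


theorem piece_poly (m : ℕ) {x y : ℝ} (hxy : x ≤ y) {A ζ η : ℝ → ℂ} (hA : ContinuousOn A (Set.Icc x y))
    (hζ : ContinuousOn ζ (Set.Icc x y)) (hη : ContinuousOn η (Set.Icc x y)) (N : ℝ) :
    ∃ P : Polynomial ℂ, P.natDegree ≤ m ∧
      ∀ Z, P.eval Z = ∫ t in x..y, A t * (N * η t * kk m (N * η t * (ζ t - Z))) := by
  classical
  let lin : ℝ → Polynomial ℂ := fun t =>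
    Polynomial.C (N * η t * ζ t) - Polynomial.C (N * η t) * Polynomial.X
  let c : ℕ → ℂ := fun j => ((-1) ^ j * (2 ^ (j + 2) - 1) / ((j + 2).factorial : ℂ))
  let G : ℝ → Polynomial ℂ := fun t => ∑ j ∈ Finset.range m, Polynomial.C (c j) * lin t ^ j
  have hlin : ∀ k, ContinuousOn (fun t => (lin t).coeff k) (Set.Icc x y) := by
    intro k
    have h1 : ContinuousOn (fun t => (N : ℂ) * η t * ζ t) (Set.Icc x y) := (continuousOn_const.mul hη).mul hζ
    have h2 : ContinuousOn (fun t => (N : ℂ) * η t) (Set.Icc x y) := (continuousOn_const.mul hη)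
    simp only [lin, Polynomial.coeff_sub, Polynomial.coeff_C_mul, Polynomial.coeff_C, Polynomial.coeff_X]
    by_cases h : k = 0
    · simp only [h, if_true]; exact h1.sub (h2.mul continuousOn_const)
    · simp only [h, if_false]; exact continuousOn_const.sub (h2.mul continuousOn_const)
  have hpow : ∀ j k, ContinuousOn (fun t => (lin t ^ j).coeff k) (Set.Icc x y) := by
    intro j
    induction j with
    | zero => intro k; simp only [pow_zero]; exact continuousOn_const
    | succ j ih =>
      intro k
      simp only [pow_succ, Polynomial.coeff_mul]
      exact continuousOn_finsetSum _ fun i _ => (ih _).mul (hlin _)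
  have hG : ∀ k, ContinuousOn (fun t => (G t).coeff k) (Set.Icc x y) := by
    intro k
    simp only [G, Polynomial.finsetSum_coeff, Polynomial.coeff_C_mul]
    exact continuousOn_finsetSum _ fun i _ => continuousOn_const.mul (hpow _ _)
  have hlind : ∀ t, (lin t).natDegree ≤ 1 := by
    intro t
    refine (Polynomial.natDegree_sub_le _ _).trans ?_
    rw [Polynomial.natDegree_C]
    exact max_le (by norm_num) ((Polynomial.natDegree_C_mul_le _ _).trans Polynomial.natDegree_X_le)
  have hGd : ∀ t, (G t).natDegree ≤ m := by
    intro t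
    refine Polynomial.natDegree_sum_le_of_forall_le _ _ fun j hj => ?_
    refine (Polynomial.natDegree_C_mul_le _ _).trans ?_
    refine (Polynomial.natDegree_pow_le).trans ?_
    have := hlind t
    have := Finset.mem_range.1 hj
    nlinarith
  have hGe : ∀ t Z, (G t).eval Z = kk m (N * η t * (ζ t - Z)) := by
    intro t Z
    simp only [G, lin, kk, c, Polynomial.eval_finsetSum, Polynomial.eval_mul, Polynomial.eval_C,
      Polynomial.eval_pow, Polynomial.eval_sub, Polynomial.eval_X]
    refine Finset.sum_congr rfl fun j _ => ?_
    congr 2; ring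
  let a : ℕ → ℝ → ℂ := fun k t => A t * (N * η t) * (G t).coeff k
  have ha : ∀ k, ContinuousOn (a k) (Set.Icc x y) := fun k =>
    (hA.mul (continuousOn_const.mul hη)).mul (hG k)
  refine ⟨∑ k ∈ Finset.range (m + 1), Polynomial.C (∫ t in x..y, a k t) * Polynomial.X ^ k, ?_, ?_⟩
  · refine Polynomial.natDegree_sum_le_of_forall_le _ _ fun j hj => ?_
    refine (Polynomial.natDegree_C_mul_X_pow_le _ _).trans ?_
    have := Finset.mem_range.1 hj
    omega
  · intro Z
    simp only [Polynomial.eval_finsetSum, Polynomial.eval_mul, Polynomial.eval_C,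
      Polynomial.eval_pow, Polynomial.eval_X]
    simp_rw [← intervalIntegral.integral_mul_const]
    rw [← intervalIntegral.integral_finsetSum]
    · refine intervalIntegral.integral_congr fun t _ => ?_
      simp only [a]
      rw [← hGe, Polynomial.eval_eq_sum_range' (Nat.lt_succ_of_le (hGd t)), Finset.mul_sum, Finset.mul_sum]
      refine Finset.sum_congr rfl fun j _ => ?_
      ring
    · intro k _
      refine ContinuousOn.intervalIntegrable ?_
      rw [Set.uIcc_of_le hxy]
      exact (ha k).mul continuousOn_const

theorem continuous_kk (m : ℕ) : Continuous (kk m) := by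
  unfold kk; fun_prop

theorem int_diff_le {x y : ℝ} (hxy : x ≤ y) {F G : ℝ → ℂ} {W : ℝ → ℝ} {c B : ℝ} (hc : 0 ≤ c)
    (hF : ContinuousOn F (Set.Icc x y)) (hG : ContinuousOn G (Set.Icc x y))
    (hW : ContinuousOn W (Set.Icc x y)) (h : ∀ t ∈ Set.Icc x y, ‖F t - G t‖ ≤ c * W t)
    (hB : ∫ t in x..y, W t ≤ B) : ‖(∫ t in x..y, F t) - ∫ t in x..y, G t‖ ≤ c * B := by
  rw [← Set.uIcc_of_le hxy] at hF hG hW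
  rw [← intervalIntegral.integral_sub hF.intervalIntegrable hG.intervalIntegrable]
  calc _ ≤ ∫ t in x..y, c * W t := by
        refine intervalIntegral.norm_integral_le_of_norm_le hxy ?_ (hW.intervalIntegrable.const_mul c)
        exact Filter.Eventually.of_forall fun t ht => h t (Set.Ioc_subset_Icc_self ht)
    _ = c * ∫ t in x..y, W t := intervalIntegral.integral_const_mul _ _
    _ ≤ c * B := by gcongr

/-- estimates for one boundary piece -/
theorem piece_main {D r B : ℝ} (hD : 0 ≤ D) (hr : 0 < r) : ∃ C : ℝ, 8 ≤ C ∧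
    ∀ (m : ℕ) (N x y Mg : ℝ) (A ζ η : ℝ → ℂ) (L : ℝ → ℝ) (S : Set ℂ), 0 < N → x ≤ y → 0 ≤ Mg →
    ContinuousOn A (Set.Icc x y) → ContinuousOn ζ (Set.Icc x y) → ContinuousOn η (Set.Icc x y) →
    ContinuousOn L (Set.Icc x y) → (∀ t ∈ Set.Icc x y, ‖η t‖ = 1) →
    (∀ t ∈ Set.Icc x y, ‖A t‖ ≤ Mg * L t) →
    (∀ Z ∈ S, ∀ t ∈ Set.Icc x y, 0 ≤ (η t * (ζ t - Z)).re) →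
    (∀ Z ∈ S, ∀ t ∈ Set.Icc x y, N * ‖ζ t - Z‖ ≤ m / 12) →
    (∀ Z ∈ S, ∫ t in x..y, N * L t / (1 + (N * ‖ζ t - Z‖) ^ 2) ≤ B) →
    ∃ P : Polynomial ℂ, P.natDegree ≤ m ∧
      (∀ Z ∈ S, ∀ Z' ∈ S, N * ‖Z - Z'‖ ≤ D → (∀ t ∈ Set.Icc x y, r ≤ N * (η t * (ζ t - Z')).re) →
        ‖P.eval Z - ∫ t in x..y, A t / (ζ t - Z')‖ ≤ C * Mg * B) ∧
      (∀ Z ∈ S, ∀ d : ℝ, 1 ≤ N * d → (∀ t ∈ Set.Icc x y, d ≤ (η t * (ζ t - Z)).re) →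
        ‖P.eval Z - ∫ t in x..y, A t / (ζ t - Z)‖ ≤ C * Real.exp (-(N * d)) * Mg * B) := by
  obtain ⟨C1, hC1, h1⟩ := kk_shift hD
  obtain ⟨C2, hC2, h2⟩ := kk_mid hr
  refine ⟨C1 + C2 + 8, by linarith, ?_⟩
  intro m N x y Mg A ζ η L S hN hxy hMg hA hζ hη hL hη1 hAL hre hm hB
  obtain ⟨P, hPd, hP⟩ := piece_poly m hxy hA hζ hη N
  have hL0 : ∀ t ∈ Set.Icc x y, 0 ≤ Mg * L t := fun t ht => (norm_nonneg _).trans (hAL t ht)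
  have nu : ∀ Z, ∀ t ∈ Set.Icc x y, ‖(N : ℂ) * η t * (ζ t - Z)‖ = N * ‖ζ t - Z‖ := by
    intro Z t ht
    rw [norm_mul, norm_mul, hη1 t ht, Complex.norm_of_nonneg hN.le, mul_one]
  have ru : ∀ Z t, ((N : ℂ) * η t * (ζ t - Z)).re = N * (η t * (ζ t - Z)).re := by
    intro Z t; rw [mul_assoc, Complex.re_ofReal_mul]
  have cK : ∀ Z, ContinuousOn (fun t => A t * (N * η t * kk m (N * η t * (ζ t - Z)))) (Set.Icc x y) := by
    intro Z
    refine hA.mul ((continuousOn_const.mul hη).mul ?_)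
    exact (continuous_kk m).comp_continuousOn ((continuousOn_const.mul hη).mul (hζ.sub continuousOn_const))
  have cW : ∀ Z, ContinuousOn (fun t => N * L t / (1 + (N * ‖ζ t - Z‖) ^ 2)) (Set.Icc x y) := by
    intro Z
    refine (continuousOn_const.mul hL).div ?_ (fun t _ => by positivity)
    exact continuousOn_const.add ((continuousOn_const.mul (hζ.sub continuousOn_const).norm).pow 2)
  have cQ : ∀ Z, (∀ t ∈ Set.Icc x y, 0 < (η t * (ζ t - Z)).re) →
      ContinuousOn (fun t => A t / (ζ t - Z)) (Set.Icc x y) := by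
    intro Z h
    refine hA.div (hζ.sub continuousOn_const) fun t ht h0 => ?_
    have := h t ht
    simp [h0] at this
  have invu : ∀ Z, ∀ t ∈ Set.Icc x y, 
      A t / (ζ t - Z) = A t * (N * η t * ((N : ℂ) * η t * (ζ t - Z))⁻¹) := by
    intro Z t ht
    have hN' : (N : ℂ) ≠ 0 := by exact_mod_cast hN.ne'
    have he : η t ≠ 0 := by rw [← norm_pos_iff, hη1 t ht]; norm_num
    rw [mul_inv, div_eq_mul_inv, ← mul_assoc ((N : ℂ) * η t), mul_inv_cancel₀ (mul_ne_zero hN' he), one_mul]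
  have gen : ∀ t ∈ Set.Icc x y, ∀ (v v' : ℂ) (c q : ℝ), 0 < q → ‖v - v'‖ ≤ c / q →
      ‖A t * (N * η t * v) - A t * (N * η t * v')‖ ≤ c * Mg * (N * L t / q) := by
    intro t ht v v' c q hq hv
    rw [← mul_sub, ← mul_sub, norm_mul, norm_mul, norm_mul, hη1 t ht, Complex.norm_of_nonneg hN.le, mul_one]
    calc _ ≤ (Mg * L t) * (N * (c / q)) := by
          have := hAL t ht
          have := hL0 t ht
          gcongr
      _ = _ := by ring
  refine ⟨P, hPd, ?_, ?_⟩
  · intro Z hZ Z' hZ' hd hr'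
    have hpos : ∀ t ∈ Set.Icc x y, 0 < (η t * (ζ t - Z')).re := by
      intro t ht
      have := hr' t ht
      by_contra hcon
      nlinarith
    have e1 : ‖P.eval Z - P.eval Z'‖ ≤ C1 * Mg * B := by
      rw [hP, hP]
      refine int_diff_le hxy (by positivity) (cK Z) (cK Z') (cW Z) ?_ (hB Z hZ)
      intro t ht
      refine gen t ht _ _ _ _ (by positivity) ?_
      rw [← nu Z t ht]
      refine h1 m _ _ ?_ ?_ ?_ ?_ ?_
      · rw [nu Z t ht]; exact hm Z hZ t ht
      · rw [nu Z' t ht]; exact hm Z' hZ' t ht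
      · rw [ru]; exact mul_nonneg hN.le (hre Z hZ t ht)
      · rw [ru]; exact mul_nonneg hN.le (hre Z' hZ' t ht)
      · rw [← mul_sub, norm_mul, norm_mul, hη1 t ht, Complex.norm_of_nonneg hN.le, mul_one,
          sub_sub_sub_cancel_left, norm_sub_rev]
        exact hd
    have e2 : ‖P.eval Z' - ∫ t in x..y, A t / (ζ t - Z')‖ ≤ C2 * Mg * B := by
      rw [hP]
      refine int_diff_le hxy (by positivity) (cK Z') (cQ Z' hpos) (cW Z') ?_ (hB Z' hZ')
      intro t ht
      rw [invu Z' t ht]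
      refine gen t ht _ _ _ _ (by positivity) ?_
      rw [← nu Z' t ht]
      refine h2 m _ ?_ ?_
      · rw [nu Z' t ht]; exact hm Z' hZ' t ht
      · rw [ru]; exact hr' t ht
    have hnn : 0 ≤ Mg * B := by
      have := (norm_nonneg _).trans e2
      rw [mul_assoc] at this
      exact nonneg_of_mul_nonneg_right this hC2
    calc _ = ‖(P.eval Z - P.eval Z') + (P.eval Z' - ∫ t in x..y, A t / (ζ t - Z'))‖ := by congr 1; ring
      _ ≤ _ := norm_add_le _ _
      _ ≤ C1 * Mg * B + C2 * Mg * B := by linarith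
      _ ≤ _ := by nlinarith
  · intro Z hZ d hd hdt
    have hd0 : 0 < d := by
      by_contra hcon
      nlinarith
    have e2 : ‖P.eval Z - ∫ t in x..y, A t / (ζ t - Z)‖ ≤ 8 * Real.exp (-(N * d)) * Mg * B := by
      rw [hP]
      refine int_diff_le hxy (by positivity) (cK Z) (cQ Z fun t ht => hd0.trans_le (hdt t ht)) (cW Z) ?_ (hB Z hZ)
      intro t ht
      rw [invu Z t ht]
      refine gen t ht _ _ _ _ (by positivity) ?_
      rw [← nu Z t ht]
      refine kk_exp ?_ hd ?_
      · rw [nu Z t ht]; exact hm Z hZ t ht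
      · rw [ru]; have := hdt t ht; gcongr
    refine e2.trans ?_
    have hnn : 0 ≤ Real.exp (-(N * d)) * Mg * B := by
      have := (norm_nonneg _).trans e2
      rw [mul_assoc, mul_assoc] at this
      rw [mul_assoc]
      exact nonneg_of_mul_nonneg_right this (by norm_num)
    nlinarith


theorem ray_weight {R N c : ℝ} (hR : 0 < R) (hN : 0 < N) {ζ : ℝ → ℂ} {Z : ℂ}
    (hζ : ContinuousOn ζ (Set.Icc 0 R)) (h : ∀ t ∈ Set.Icc 0 R, |t ^ 2 - c| ≤ ‖ζ t - Z‖) :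
    ∫ t in (0 : ℝ)..R, N * (2 * t) / (1 + (N * ‖ζ t - Z‖) ^ 2) ≤ Real.pi ^ 2 := by
  have hd : ∀ t ∈ Set.uIcc 0 R, HasDerivAt (fun t : ℝ => Real.arctan (N * (t ^ 2 - c)))
      (N * (2 * t) / (1 + (N * (t ^ 2 - c)) ^ 2)) t := by
    intro t _
    have h1 : HasDerivAt (fun t : ℝ => N * (t ^ 2 - c)) (N * (2 * t)) t := by
      have := ((hasDerivAt_pow 2 t).sub_const c).const_mul N
      simpa using this
    have := h1.arctan
    convert this using 1
    ring
  have hc : ContinuousOn (fun t : ℝ => N * (2 * t) / (1 + (N * (t ^ 2 - c)) ^ 2)) (Set.uIcc 0 R) := by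
    refine ContinuousOn.div (by fun_prop) (by fun_prop) (fun t _ => by positivity)
  have e := intervalIntegral.integral_eq_sub_of_hasDerivAt hd hc.intervalIntegrable
  have c2 : ContinuousOn (fun t => N * (2 * t) / (1 + (N * ‖ζ t - Z‖) ^ 2)) (Set.uIcc 0 R) := by
    rw [Set.uIcc_of_le hR.le]
    refine ContinuousOn.div (by fun_prop) ?_ (fun t _ => by positivity)
    exact continuousOn_const.add ((continuousOn_const.mul (hζ.sub continuousOn_const).norm).pow 2)
  calc _ ≤ ∫ t in (0 : ℝ)..R, N * (2 * t) / (1 + (N * (t ^ 2 - c)) ^ 2) := by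
        refine intervalIntegral.integral_mono_on hR.le c2.intervalIntegrable hc.intervalIntegrable ?_
        intro t ht
        have h1 := h t ht
        have h2 : (N * (t ^ 2 - c)) ^ 2 ≤ (N * ‖ζ t - Z‖) ^ 2 := by
          apply sq_le_sq.2
          rw [abs_mul, abs_mul, abs_norm]
          gcongr
        have := ht.1
        gcongr
    _ ≤ Real.pi := by
      rw [e]
      generalize N * (R ^ 2 - c) = p
      generalize N * (0 ^ 2 - c) = q
      linarith [Real.arctan_lt_pi_div_two p, Real.neg_pi_div_two_lt_arctan q]
    _ ≤ _ := by nlinarith [Real.pi_gt_three]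

theorem arc_weight {b N k ρ c : ℝ} (hb : 0 < b) (hN : 0 < N) (hρ : 0 < ρ) (hk : k = 2 * ρ / Real.pi) {ζ : ℝ → ℂ} {Z : ℂ}
    (hζ : ContinuousOn ζ (Set.Icc (-b) b)) (h : ∀ t ∈ Set.Icc (-b) b, k * |t - c| ≤ ‖ζ t - Z‖) :
    ∫ t in (-b)..b, N * (2 * ρ) / (1 + (N * ‖ζ t - Z‖) ^ 2) ≤ Real.pi ^ 2 := by
  have hk0 : 0 < k := by rw [hk]; positivity
  have hd : ∀ t ∈ Set.uIcc (-b) b, HasDerivAt (fun t : ℝ => Real.pi * Real.arctan (N * k * (t - c)))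
      (N * (2 * ρ) / (1 + (N * k * (t - c)) ^ 2)) t := by
    intro t _
    have h1 : HasDerivAt (fun t : ℝ => N * k * (t - c)) (N * k) t := by
      have := ((hasDerivAt_id t).sub_const c).const_mul (N * k)
      simpa using this
    have := h1.arctan.const_mul Real.pi
    have e : N * (2 * ρ) / (1 + (N * k * (t - c)) ^ 2) = Real.pi * (1 / (1 + (N * k * (t - c)) ^ 2) * (N * k)) := by
      have : Real.pi * k = 2 * ρ := by rw [hk]; field_simp
      rw [← this]; ring
    rw [e]
    exact this
  have hbb : -b ≤ b := by linarith
  have hc : ContinuousOn (fun t : ℝ => N * (2 * ρ) / (1 + (N * k * (t - c)) ^ 2)) (Set.uIcc (-b) b) := by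
    refine ContinuousOn.div (by fun_prop) (by fun_prop) (fun t _ => by positivity)
  have e := intervalIntegral.integral_eq_sub_of_hasDerivAt hd hc.intervalIntegrable
  have c2 : ContinuousOn (fun t => N * (2 * ρ) / (1 + (N * ‖ζ t - Z‖) ^ 2)) (Set.uIcc (-b) b) := by
    rw [Set.uIcc_of_le hbb]
    refine ContinuousOn.div (by fun_prop) ?_ (fun t _ => by positivity)
    exact continuousOn_const.add ((continuousOn_const.mul (hζ.sub continuousOn_const).norm).pow 2)
  calc _ ≤ ∫ t in (-b)..b, N * (2 * ρ) / (1 + (N * k * (t - c)) ^ 2) := by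
        refine intervalIntegral.integral_mono_on hbb c2.intervalIntegrable hc.intervalIntegrable ?_
        intro t ht
        have h1 := h t ht
        have h2 : (N * k * (t - c)) ^ 2 ≤ (N * ‖ζ t - Z‖) ^ 2 := by
          apply sq_le_sq.2
          rw [mul_assoc, abs_mul, abs_mul, abs_mul N, abs_norm, abs_of_pos hk0]
          gcongr
        gcongr
    _ ≤ _ := by
      rw [e]
      nlinarith [Real.arctan_lt_pi_div_two (N * k * (b - c)), Real.neg_pi_div_two_lt_arctan (N * k * (-b - c)), Real.pi_pos]

theorem lray_dist {t b : ℝ} (Z : ℂ) :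
    |t ^ 2 - (Complex.exp ((2 * b : ℝ) * Complex.I) * Z).re| ≤
      ‖((t : ℂ) * Complex.exp ((-b : ℝ) * Complex.I)) ^ 2 - Z‖ := by
  have h := Complex.abs_re_le_norm (Complex.exp ((2 * b : ℝ) * Complex.I) * (((t : ℂ) * Complex.exp ((-b : ℝ) * Complex.I)) ^ 2 - Z))
  rw [norm_mul, Complex.norm_exp_ofReal_mul_I, one_mul] at h
  refine le_of_eq_of_le ?_ h
  rw [mul_sub, Complex.sub_re, mul_pow, ← Complex.exp_nat_mul, mul_left_comm, ← Complex.exp_add]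
  congr 2
  have : (((2 * b : ℝ) : ℂ) * Complex.I + ((2 : ℕ) : ℂ) * (((-b : ℝ) : ℂ) * Complex.I)) = 0 := by push_cast; ring
  rw [this, Complex.exp_zero, mul_one, ← Complex.ofReal_pow, Complex.ofReal_re]

theorem arc_dist {ρ b t : ℝ} (hρ : 0 < ρ) (hb0 : 0 < b) (hb : b ≤ Real.pi / 4) (ht : t ∈ Set.Icc (-b) b) {s ψ : ℝ} (hs : 0 ≤ s)
    (hsρ : s ≤ ρ) (hψ : |ψ| ≤ b) :
    2 * ρ / Real.pi * |t - ψ| ≤ ‖(ρ : ℂ) * Complex.exp ((2 * t : ℝ) * Complex.I) -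
      s * Complex.exp ((2 * ψ : ℝ) * Complex.I)‖ := by
  have h1 : 2 / Real.pi * |t - ψ| ≤ |Real.sin (t - ψ)| := by
    apply Real.mul_abs_le_abs_sin
    rw [abs_le] at *
    obtain ⟨_, _⟩ := ht
    constructor <;> linarith
  have h2 : ρ * |Real.sin (t - ψ)| ≤ ‖(ρ : ℂ) * Complex.exp ((2 * t : ℝ) * Complex.I) -
      s * Complex.exp ((2 * ψ : ℝ) * Complex.I)‖ := by
    apply le_of_sq_le_sq ?_ (norm_nonneg _) |> fun h => h
    rw [Complex.sq_norm, Complex.normSq_apply, Complex.sub_re, Complex.sub_im, polar_re, polar_im, polar_re, polar_im,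
      mul_pow, sq_abs]
    have c1 : Real.cos (2 * t) * Real.cos (2 * ψ) + Real.sin (2 * t) * Real.sin (2 * ψ) = 1 - 2 * Real.sin (t - ψ) ^ 2 := by
      rw [← Real.cos_sub, ← mul_sub, Real.cos_two_mul, Real.cos_sq']; ring
    have c2 := Real.sin_sq_add_cos_sq (2 * t)
    have c3 := Real.sin_sq_add_cos_sq (2 * ψ)
    have c4 : Real.sin (t - ψ) ^ 2 ≤ 1 := Real.sin_sq_le_one _
    set q := Real.sin (t - ψ) ^ 2 with hq
    have c5 : 0 ≤ q := sq_nonneg _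
    have e : (ρ * Real.cos (2 * t) - s * Real.cos (2 * ψ)) * (ρ * Real.cos (2 * t) - s * Real.cos (2 * ψ)) +
      (ρ * Real.sin (2 * t) - s * Real.sin (2 * ψ)) * (ρ * Real.sin (2 * t) - s * Real.sin (2 * ψ)) = ρ ^ 2 + s ^ 2 - 2 * ρ * s * (1 - 2 * q) := by
      linear_combination ρ ^ 2 * c2 + s ^ 2 * c3 - 2 * ρ * s * c1
    rw [e]
    rcases le_total q (1 / 2) with hh | hh
    · have : 0 ≤ ρ ^ 2 * (q * (3 - 4 * q)) := by
        have : 0 ≤ 3 - 4 * q := by linarith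
        positivity
      nlinarith [sq_nonneg (s - ρ * (1 - 2 * q))]
    · have : 0 ≤ 2 * ρ * s * (2 * q - 1) := by
        have : 0 ≤ 2 * q - 1 := by linarith
        positivity
      nlinarith [sq_nonneg s, sq_nonneg ρ]
  calc _ = ρ * (2 / Real.pi * |t - ψ|) := by ring
    _ ≤ ρ * |Real.sin (t - ψ)| := by gcongr
    _ ≤ _ := h2

theorem lray_eta {t b : ℝ} (Z : ℂ) :
    (Complex.I * Complex.exp ((2 * b : ℝ) * Complex.I) * (((t : ℂ) * Complex.exp ((-b : ℝ) * Complex.I)) ^ 2 - Z)).re =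
      Real.sin (2 * b) * Z.re + Real.cos (2 * b) * Z.im := by
  rw [polar_sq]
  have h1 := Complex.exp_ofReal_mul_I_re (2 * b)
  have h2 := Complex.exp_ofReal_mul_I_im (2 * b)
  simp only [Complex.mul_re, Complex.mul_im, Complex.sub_re, Complex.sub_im, polar_re, polar_im, h1, h2, Complex.I_re, Complex.I_im,
    Complex.exp_ofReal_mul_I_re, Complex.exp_ofReal_mul_I_im, Complex.ofReal_re, Complex.ofReal_im]
  rw [show 2 * (-b) = -(2 * b) by ring, Real.sin_neg, Real.cos_neg]
  ring

theorem arc_eta {R t : ℝ} (Z : ℂ) :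
    R ^ 2 - ‖Z‖ ≤ (Complex.exp ((-(2 * t) : ℝ) * Complex.I) * (((R : ℂ) * Complex.exp (t * Complex.I)) ^ 2 - Z)).re := by
  have h := Complex.re_le_norm (Complex.exp ((-(2 * t) : ℝ) * Complex.I) * Z)
  rw [norm_mul, Complex.norm_exp_ofReal_mul_I, one_mul] at h
  rw [mul_sub, Complex.sub_re]
  have : (Complex.exp ((-(2 * t) : ℝ) * Complex.I) * ((R : ℂ) * Complex.exp (t * Complex.I)) ^ 2) = ((R ^ 2 : ℝ) : ℂ) := by
    rw [mul_pow, ← Complex.exp_nat_mul, mul_left_comm, ← Complex.exp_add]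
    have : (((-(2 * t) : ℝ) : ℂ) * Complex.I + ((2 : ℕ) : ℂ) * ((t : ℂ) * Complex.I)) = 0 := by push_cast; ring
    rw [this, Complex.exp_zero]; push_cast; ring
  rw [this, Complex.ofReal_re]
  linarith


theorem uray_dist {t b : ℝ} (Z : ℂ) :
    |t ^ 2 - (Complex.exp ((2 * (-b) : ℝ) * Complex.I) * Z).re| ≤
      ‖((t : ℂ) * Complex.exp (b * Complex.I)) ^ 2 - Z‖ := by
  have := lray_dist (t := t) (b := -b) Z
  rwa [neg_neg] at this

theorem uray_eta {t b : ℝ} (Z : ℂ) :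
    (-(Complex.I * Complex.exp ((2 * (-b) : ℝ) * Complex.I)) * (((t : ℂ) * Complex.exp (b * Complex.I)) ^ 2 - Z)).re =
      Real.sin (2 * b) * Z.re - Real.cos (2 * b) * Z.im := by
  have := lray_eta (t := t) (b := -b) Z
  rw [neg_neg] at this
  rw [neg_mul, Complex.neg_re, this, show 2 * (-b) = -(2 * b) by ring, Real.sin_neg, Real.cos_neg]
  ring

theorem arc_dist' {R b : ℝ} (hb0 : 0 < b) (hb : b ≤ Real.pi / 4) (hR : 0 < R) {Z : ℂ}
    (hZ : Z ∈ sec (2 * b) (R ^ 2)) : ∃ ψ : ℝ, ∀ t ∈ Set.Icc (-b) b,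
    2 * R ^ 2 / Real.pi * |t - ψ| ≤ ‖((R : ℂ) * Complex.exp (t * Complex.I)) ^ 2 - Z‖ := by
  obtain ⟨s, θ, h1, h2, h3, rfl⟩ := exists_polar_sec (by linarith) (by linarith) hZ
  refine ⟨θ / 2, fun t ht => ?_⟩
  have h4 : |θ / 2| ≤ b := by rw [abs_div, abs_two]; linarith
  have := arc_dist (ρ := R ^ 2) (by positivity) hb0 hb ht h1 h2 h4
  rw [polar_sq]
  rwa [show 2 * (θ / 2) = θ by ring] at this

theorem sector_op {b R : ℝ} (hb0 : 0 < b) (hb : b ≤ Real.pi / 4) (hR : 0 < R) :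
    ∃ C : ℝ, 1 ≤ C ∧ ∀ (m : ℕ) (N : ℝ), N = m / (24 * R ^ 2) → 1 ≤ N →
    ∀ (g : ℂ → ℂ) (Mg : ℝ), 0 ≤ Mg → ContinuousOn g (sec b R) → DifferentiableOn ℂ g (osec b R) →
      (∀ w ∈ sec b R, ‖g w‖ ≤ Mg) → ∃ H : Polynomial ℂ, H.natDegree ≤ m ∧
      (∀ Z ∈ sec (2 * b) (R ^ 2), ‖H.eval Z‖ ≤ C * Mg) ∧
      (∀ w ∈ osec b R, ∀ d : ℝ, d ≤ Real.sin (2 * b) * (w ^ 2).re - Real.cos (2 * b) * (w ^ 2).im →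
        d ≤ Real.sin (2 * b) * (w ^ 2).re + Real.cos (2 * b) * (w ^ 2).im → d ≤ R ^ 2 - ‖w ^ 2‖ →
        ‖g w - H.eval (w ^ 2)‖ ≤ C * Mg * Real.exp (-(N * d))) := by
  have hb2 : b ≤ Real.pi / 2 := by linarith
  have hpi := Real.pi_pos
  have hs2 : 0 < Real.sin (2 * b) := Real.sin_pos_of_pos_of_lt_pi (by linarith) (by linarith)
  set r : ℝ := min (R ^ 2 * Real.sin (2 * b) / 2) (R ^ 2 / 2) with hrdef
  have hr : 0 < r := lt_min (by positivity) (by positivity)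
  obtain ⟨C0, hC0, hmain⟩ := piece_main (D := 2 * R ^ 2) (r := r) (B := Real.pi ^ 2) (by positivity) hr
  set C1 : ℝ := 3 * C0 * Real.pi ^ 2 + 1 with hC1
  have hC11 : 1 ≤ C1 := by
    have : 0 ≤ 3 * C0 * Real.pi ^ 2 := by positivity
    linarith
  refine ⟨6 * C1, by linarith, ?_⟩
  intro m N hNm hN g Mg hMg hg hgd hgb
  have hN0 : 0 < N := by linarith
  have hm : ∀ ζ Z : ℂ, ‖ζ‖ ≤ R ^ 2 → ‖Z‖ ≤ R ^ 2 → N * ‖ζ - Z‖ ≤ m / 12 := by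
    intro ζ Z h1 h2
    calc _ ≤ N * (‖ζ‖ + ‖Z‖) := by gcongr; exact norm_sub_le _ _
      _ ≤ N * (R ^ 2 + R ^ 2) := by gcongr
      _ = _ := by rw [hNm]; field_simp; ring
  have sqn : ∀ w ∈ sec b R, ‖w ^ 2‖ ≤ R ^ 2 := fun w hw => by
    rw [norm_pow]; have := hw.2.2; gcongr
  -- lower ray
  obtain ⟨P1, hd1, hP1, hQ1⟩ := hmain m N 0 R Mg
    (fun t => g (t * Complex.exp ((-b : ℝ) * Complex.I)) * (2 * (t * Complex.exp ((-b : ℝ) * Complex.I))) * Complex.exp ((-b : ℝ) * Complex.I))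
    (fun t => (t * Complex.exp ((-b : ℝ) * Complex.I)) ^ 2)
    (fun _ => Complex.I * Complex.exp ((2 * b : ℝ) * Complex.I)) (fun t => 2 * t) (sec (2 * b) (R ^ 2)) hN0 hR.le hMg
    (by
      refine ContinuousOn.mul (ContinuousOn.mul ?_ (by fun_prop)) (by fun_prop)
      exact hg.comp (by fun_prop) (fun t ht => lray_mem hb0 hb2 ht))
    (by fun_prop) (by fun_prop) (by fun_prop)
    (by intro t _; rw [norm_mul, Complex.norm_I, Complex.norm_exp_ofReal_mul_I, one_mul])
    (by
      intro t ht
      rw [norm_mul, norm_mul, Complex.norm_exp_ofReal_mul_I, mul_one, norm_mul, Complex.norm_two, polar_norm ht.1]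
      have := hgb _ (lray_mem hb0 hb2 ht)
      have := ht.1
      gcongr)
    (by intro Z hZ t ht; rw [lray_eta]; exact hZ.2.1)
    (by intro Z hZ t ht; exact hm _ _ (sqn _ (lray_mem hb0 hb2 ht)) hZ.2.2)
    (by
      intro Z hZ
      exact ray_weight hR hN0 (by fun_prop) (fun t _ => lray_dist Z))
  -- arc
  obtain ⟨P2, hd2, hP2, hQ2⟩ := hmain m N (-b) b Mg
    (fun t => g (R * Complex.exp (t * Complex.I)) * (2 * (R * Complex.exp (t * Complex.I))) * (R * Complex.I * Complex.exp (t * Complex.I)))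
    (fun t => (R * Complex.exp (t * Complex.I)) ^ 2)
    (fun t => Complex.exp ((-(2 * t) : ℝ) * Complex.I)) (fun _ => 2 * R ^ 2) (sec (2 * b) (R ^ 2)) hN0 (by linarith) hMg
    (by
      refine ContinuousOn.mul (ContinuousOn.mul ?_ (by fun_prop)) (by fun_prop)
      exact hg.comp (by fun_prop) (fun t ht => arc_mem hb2 hR ht))
    (by fun_prop) (by fun_prop) (by fun_prop)
    (by intro t _; rw [Complex.norm_exp_ofReal_mul_I])
    (by
      intro t ht
      rw [norm_mul, norm_mul, norm_mul, norm_mul, norm_mul, norm_mul, Complex.norm_exp_ofReal_mul_I, mul_one, Complex.norm_two,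
        Complex.norm_I, mul_one, mul_one, Complex.norm_of_nonneg hR.le]
      have := hgb _ (arc_mem hb2 hR ht)
      calc _ ≤ Mg * (2 * R) * R := by gcongr
        _ = _ := by ring)
    (by intro Z hZ t ht; exact le_trans (by linarith [hZ.2.2]) (arc_eta Z))
    (by intro Z hZ t ht; exact hm _ _ (sqn _ (arc_mem hb2 hR ht)) hZ.2.2)
    (by
      intro Z hZ
      obtain ⟨ψ, hψ⟩ := arc_dist' hb0 hb hR hZ
      exact arc_weight hb0 hN0 (by positivity) rfl (by fun_prop) hψ)
  -- upper ray
  obtain ⟨P3, hd3, hP3, hQ3⟩ := hmain m N 0 R Mg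
    (fun t => g (t * Complex.exp (b * Complex.I)) * (2 * (t * Complex.exp (b * Complex.I))) * Complex.exp (b * Complex.I))
    (fun t => (t * Complex.exp (b * Complex.I)) ^ 2)
    (fun _ => -(Complex.I * Complex.exp ((2 * (-b) : ℝ) * Complex.I))) (fun t => 2 * t) (sec (2 * b) (R ^ 2)) hN0 hR.le hMg
    (by
      refine ContinuousOn.mul (ContinuousOn.mul ?_ (by fun_prop)) (by fun_prop)
      exact hg.comp (by fun_prop) (fun t ht => uray_mem hb0 hb2 ht))
    (by fun_prop) (by fun_prop) (by fun_prop)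
    (by intro t _; rw [norm_neg, norm_mul, Complex.norm_I, Complex.norm_exp_ofReal_mul_I, one_mul])
    (by
      intro t ht
      rw [norm_mul, norm_mul, Complex.norm_exp_ofReal_mul_I, mul_one, norm_mul, Complex.norm_two, polar_norm ht.1]
      have := hgb _ (uray_mem hb0 hb2 ht)
      have := ht.1
      gcongr)
    (by intro Z hZ t ht; rw [uray_eta]; exact hZ.1)
    (by intro Z hZ t ht; exact hm _ _ (sqn _ (uray_mem hb0 hb2 ht)) hZ.2.2)
    (by
      intro Z hZ
      exact ray_weight hR hN0 (by fun_prop) (fun t _ => uray_dist Z))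
  have h2pi : (2 * Real.pi * Complex.I : ℂ) ≠ 0 := Complex.two_pi_I_ne_zero
  have n2pi : 1 ≤ ‖(2 * Real.pi * Complex.I : ℂ)‖ := by
    rw [norm_mul, norm_mul, Complex.norm_I, Complex.norm_two, Complex.norm_of_nonneg hpi.le]
    linarith [Real.pi_gt_three]
  have cau : ∀ w ∈ osec b R, 2 * Real.pi * Complex.I * g w =
      (∫ t in (0 : ℝ)..R, g (t * Complex.exp ((-b : ℝ) * Complex.I)) * (2 * (t * Complex.exp ((-b : ℝ) * Complex.I))) * Complex.exp ((-b : ℝ) * Complex.I) / ((t * Complex.exp ((-b : ℝ) * Complex.I)) ^ 2 - w ^ 2))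
      + (∫ t in (-b)..b, g (R * Complex.exp (t * Complex.I)) * (2 * (R * Complex.exp (t * Complex.I))) * (R * Complex.I * Complex.exp (t * Complex.I)) / ((R * Complex.exp (t * Complex.I)) ^ 2 - w ^ 2))
      - ∫ t in (0 : ℝ)..R, g (t * Complex.exp (b * Complex.I)) * (2 * (t * Complex.exp (b * Complex.I))) * Complex.exp (b * Complex.I) / ((t * Complex.exp (b * Complex.I)) ^ 2 - w ^ 2) := by
    intro w hw
    rw [← cauchy_sector hb0 hb hR hg hgd hw]
    unfold CI
    congr 1
    · congr 1
      · exact intervalIntegral.integral_congr fun t _ => div_mul_eq_mul_div _ _ _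
      · exact intervalIntegral.integral_congr fun t _ => div_mul_eq_mul_div _ _ _
    · exact intervalIntegral.integral_congr fun t _ => div_mul_eq_mul_div _ _ _
  set H : Polynomial ℂ := Polynomial.C (2 * Real.pi * Complex.I)⁻¹ * (P1 + P2 - P3) with hH
  have comb : ∀ (Z a1 a2 a3 v : ℂ) (e : ℝ), 2 * Real.pi * Complex.I * v = a1 + a2 - a3 →
      ‖P1.eval Z - a1‖ ≤ e → ‖P2.eval Z - a2‖ ≤ e → ‖P3.eval Z - a3‖ ≤ e → ‖H.eval Z - v‖ ≤ 3 * e := by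
    intro Z a1 a2 a3 v e hv h1 h2 h3
    have e1 : H.eval Z - v = (2 * Real.pi * Complex.I)⁻¹ * ((P1.eval Z - a1) + (P2.eval Z - a2) - (P3.eval Z - a3)) := by
      have : v = (2 * Real.pi * Complex.I)⁻¹ * (a1 + a2 - a3) := by rw [← hv, inv_mul_cancel_left₀ h2pi]
      rw [hH, Polynomial.eval_mul, Polynomial.eval_C, Polynomial.eval_sub, Polynomial.eval_add]
      linear_combination -this
    rw [e1, norm_mul, norm_inv]
    calc _ ≤ 1 * ‖(P1.eval Z - a1) + (P2.eval Z - a2) - (P3.eval Z - a3)‖ := by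
          gcongr; exact inv_le_one_of_one_le₀ n2pi
      _ ≤ 1 * (‖(P1.eval Z - a1)‖ + ‖(P2.eval Z - a2)‖ + ‖(P3.eval Z - a3)‖) := by
          gcongr; exact (norm_sub_le _ _).trans (by gcongr; exact norm_add_le _ _)
      _ ≤ _ := by linarith
  have hbound : ∀ Z ∈ sec (2 * b) (R ^ 2), ‖H.eval Z‖ ≤ C1 * Mg := by
    intro Z hZ
    have hz0 : ((R ^ 2 / 2 : ℝ) : ℂ) ∈ osec (2 * b) (R ^ 2) := half_mem_osec (by linarith) (by linarith) (by positivity)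
    have hNi : 0 < 1 / N := by positivity
    have hNi1 : 1 / N ≤ 1 := by rw [div_le_one hN0]; exact hN
    have hNN : N * (1 / N) = 1 := by field_simp
    set Z' : ℂ := ((1 - 1 / N : ℝ) : ℂ) * Z + ((1 / N : ℝ) : ℂ) * ((R ^ 2 / 2 : ℝ) : ℂ) with hZ'def
    have hZ' : Z' ∈ osec (2 * b) (R ^ 2) := comb_mem_osec hZ hz0 (by linarith) hNi (by ring)
    obtain ⟨w, hw, hwZ⟩ := exists_sq_osec hb0 hb hR hZ'
    have hre : Z'.re = (1 - 1 / N) * Z.re + 1 / N * (R ^ 2 / 2) := by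
      rw [hZ'def, Complex.add_re, Complex.re_ofReal_mul, Complex.re_ofReal_mul, Complex.ofReal_re]
    have him : Z'.im = (1 - 1 / N) * Z.im := by
      rw [hZ'def, Complex.add_im, Complex.im_ofReal_mul, Complex.im_ofReal_mul, Complex.ofReal_im, mul_zero, add_zero]
    have hno : ‖Z'‖ ≤ (1 - 1 / N) * R ^ 2 + 1 / N * (R ^ 2 / 2) := by
      refine (norm_add_le _ _).trans ?_
      rw [norm_mul, norm_mul, Complex.norm_of_nonneg (by linarith), Complex.norm_of_nonneg hNi.le,
        Complex.norm_of_nonneg (by positivity)]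
      have := hZ.2.2
      have : 0 ≤ 1 - 1 / N := by linarith
      gcongr
    have hD : N * ‖Z - Z'‖ ≤ 2 * R ^ 2 := by
      have : Z - Z' = ((1 / N : ℝ) : ℂ) * (Z - ((R ^ 2 / 2 : ℝ) : ℂ)) := by rw [hZ'def]; push_cast; ring
      rw [this, norm_mul, Complex.norm_of_nonneg hNi.le, ← mul_assoc, hNN, one_mul]
      refine (norm_sub_le _ _).trans ?_
      rw [Complex.norm_of_nonneg (by positivity)]
      have := hZ.2.2
      have : 0 < R ^ 2 := by positivity
      linarith
    have hm1 : r ≤ N * (Real.sin (2 * b) * Z'.re + Real.cos (2 * b) * Z'.im) := by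
      have e1 : N * (Real.sin (2 * b) * Z'.re + Real.cos (2 * b) * Z'.im) =
        (N - N * (1 / N)) * (Real.sin (2 * b) * Z.re + Real.cos (2 * b) * Z.im) + (N * (1 / N)) * (R ^ 2 * Real.sin (2 * b) / 2) := by
        rw [hre, him]; ring
      rw [e1, hNN]
      have := mul_nonneg (sub_nonneg.2 hN) hZ.2.1
      linarith [min_le_left (R ^ 2 * Real.sin (2 * b) / 2) (R ^ 2 / 2)]
    have hm2 : r ≤ N * (Real.sin (2 * b) * Z'.re - Real.cos (2 * b) * Z'.im) := by
      have e1 : N * (Real.sin (2 * b) * Z'.re - Real.cos (2 * b) * Z'.im) =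
        (N - N * (1 / N)) * (Real.sin (2 * b) * Z.re - Real.cos (2 * b) * Z.im) + (N * (1 / N)) * (R ^ 2 * Real.sin (2 * b) / 2) := by
        rw [hre, him]; ring
      rw [e1, hNN]
      have := mul_nonneg (sub_nonneg.2 hN) hZ.1
      linarith [min_le_left (R ^ 2 * Real.sin (2 * b) / 2) (R ^ 2 / 2)]
    have hm3 : r ≤ N * (R ^ 2 - ‖Z'‖) := by
      have e1 : N * (R ^ 2 - ‖Z'‖) ≥ N * (R ^ 2 - ((1 - 1 / N) * R ^ 2 + 1 / N * (R ^ 2 / 2))) := by gcongr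
      have e2 : N * (R ^ 2 - ((1 - 1 / N) * R ^ 2 + 1 / N * (R ^ 2 / 2))) = N * (1 / N) * (R ^ 2 / 2) := by ring
      rw [e2, hNN] at e1
      linarith [min_le_right (R ^ 2 * Real.sin (2 * b) / 2) (R ^ 2 / 2)]
    have hZ's := osec_subset_sec _ _ hZ'
    have k1 := hP1 Z hZ Z' hZ's hD (fun t ht => by rw [lray_eta]; exact hm1)
    have k2 := hP2 Z hZ Z' hZ's hD (fun t ht => hm3.trans (mul_le_mul_of_nonneg_left (arc_eta Z') hN0.le))
    have k3 := hP3 Z hZ Z' hZ's hD (fun t ht => by rw [uray_eta]; exact hm2)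
    rw [← hwZ] at k1 k2 k3
    have k := comb Z _ _ _ _ _ (cau w hw) k1 k2 k3
    have k4 := hgb w (osec_subset_sec _ _ hw)
    calc ‖H.eval Z‖ = ‖(H.eval Z - g w) + g w‖ := by rw [sub_add_cancel]
      _ ≤ _ := norm_add_le _ _
      _ ≤ 3 * (C0 * Mg * Real.pi ^ 2) + Mg := by linarith
      _ = _ := by rw [hC1]; ring
  refine ⟨H, ?_, ?_, ?_⟩
  · refine (Polynomial.natDegree_C_mul_le _ _).trans ?_
    refine (Polynomial.natDegree_sub_le _ _).trans (max_le ?_ hd3)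
    exact (Polynomial.natDegree_add_le _ _).trans (max_le hd1 hd2)
  · intro Z hZ
    have := hbound Z hZ
    have : 0 ≤ C1 * Mg := by positivity
    linarith
  · intro w hw d h1 h2 h3
    have hws := osec_subset_sec _ _ hw
    have hZ := sq_mem_sec hb0 hb hws
    rcases le_total 1 (N * d) with h | h
    · have k1 := hQ1 _ hZ d h (fun t ht => by rw [lray_eta]; exact h2)
      have k2 := hQ2 _ hZ d h (fun t ht => h3.trans (arc_eta _))
      have k3 := hQ3 _ hZ d h (fun t ht => by rw [uray_eta]; exact h1)
      have k := comb _ _ _ _ _ _ (cau w hw) k1 k2 k3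
      rw [norm_sub_rev]
      refine k.trans ?_
      have e1 : 3 * (C0 * Real.exp (-(N * d)) * Mg * Real.pi ^ 2) = (C1 - 1) * (Mg * Real.exp (-(N * d))) := by rw [hC1]; ring
      have e2 : 0 ≤ Mg * Real.exp (-(N * d)) := by positivity
      rw [e1]
      nlinarith
    · have k1 := hbound _ hZ
      have k2 := hgb w hws
      have e1 : (1 / 3 : ℝ) ≤ Real.exp (-(N * d)) := by
        have h5 : Real.exp (-1) ≤ Real.exp (-(N * d)) := Real.exp_le_exp.2 (by linarith)
        have h6 : (1 / 3 : ℝ) ≤ Real.exp (-1) := by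
          rw [Real.exp_neg, ← one_div]
          exact one_div_le_one_div_of_le (Real.exp_pos _) (Real.exp_one_lt_d9.le.trans (by norm_num))
        linarith
      have e2 : 6 * C1 * Mg * (1 / 3) ≤ 6 * C1 * Mg * Real.exp (-(N * d)) := by gcongr
      have e3 : Mg ≤ C1 * Mg := le_mul_of_one_le_left hMg hC11
      calc _ ≤ ‖g w‖ + ‖H.eval (w ^ 2)‖ := norm_sub_le _ _
        _ ≤ _ := by linarith


/-- segment integral of the Gaussian -/
noncomputable def gseg (a c : ℂ) : ℂ := ∫ s in (0 : ℝ)..1, Complex.exp (-(a + s * c) ^ 2) * c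

theorem gseg_add (z T : ℂ) : gseg 0 z + gseg z T = gseg 0 T + gseg T z := by
  have hd : DifferentiableOn ℂ (fun z : ℂ => Complex.exp (-z ^ 2)) (Metric.ball 0 (‖z‖ + ‖T‖ + 1)) := by
    fun_prop
  obtain ⟨P, hP⟩ := hd.isExactOn_ball
  have key : ∀ a c : ℂ, ‖a‖ + ‖c‖ < ‖z‖ + ‖T‖ + 1 → gseg a c = P (a + c) - P a := by
    intro a c hac
    have h1 : ∀ s ∈ Set.uIcc (0 : ℝ) 1, HasDerivAt (fun s : ℝ => P (a + s * c)) (Complex.exp (-(a + s * c) ^ 2) * c) s := by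
      intro s hs
      rw [Set.uIcc_of_le zero_le_one] at hs
      have hm : a + s * c ∈ Metric.ball (0 : ℂ) (‖z‖ + ‖T‖ + 1) := by
        rw [mem_ball_zero_iff]
        refine lt_of_le_of_lt (norm_add_le _ _) (lt_of_le_of_lt ?_ hac)
        rw [norm_mul, Complex.norm_of_nonneg hs.1]
        have := mul_le_of_le_one_left (norm_nonneg c) hs.2
        linarith
      have h2 : HasDerivAt (fun s : ℝ => a + s * c) c s := by
        have := ((hasDerivAt_id s).ofReal_comp.mul_const c).const_add a
        simpa using this
      exact (hP _ hm).comp s h2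
    have := intervalIntegral.integral_eq_sub_of_hasDerivAt h1 (Continuous.intervalIntegrable (by fun_prop) _ _)
    unfold gseg
    rw [this]
    simp
  rw [key 0 z (by rw [norm_zero]; linarith [norm_nonneg z, norm_nonneg T]), key z T (by linarith), key 0 T (by rw [norm_zero]; linarith [norm_nonneg z, norm_nonneg T]), key T z (by linarith)]
  rw [add_comm T z]; ring

theorem gauss_lim : Tendsto (fun T : ℝ => ∫ x in (0 : ℝ)..T, Real.exp (-1 * x ^ 2)) atTop (nhds (Real.sqrt Real.pi / 2)) := by
  have h := integral_gaussian_Ioi 1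
  rw [div_one] at h
  rw [← h]
  exact MeasureTheory.intervalIntegral_tendsto_integral_Ioi 0 (integrable_exp_neg_mul_sq one_pos).integrableOn tendsto_id

theorem gseg_bound {z : ℂ} (hz : 0 ≤ z.re) :
    ‖((Real.sqrt Real.pi / 2 : ℝ) : ℂ) - gseg 0 z‖ ≤ Real.exp (-(z ^ 2).re) * (Real.sqrt Real.pi / 2) := by
  set g : ℝ → ℝ := fun T => ∫ x in (0 : ℝ)..T, Real.exp (-1 * x ^ 2) with hg
  have g1 : ∀ T : ℝ, g T = ∫ s in (0 : ℝ)..1, Real.exp (-(s * T) ^ 2) * T := by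
    intro T
    have := intervalIntegral.mul_integral_comp_mul_right (a := 0) (b := 1) (f := fun x => Real.exp (-1 * x ^ 2)) T
    simp only [hg]
    rw [zero_mul, one_mul] at this
    rw [← this, ← intervalIntegral.integral_const_mul]
    refine intervalIntegral.integral_congr fun s _ => ?_
    simp only [neg_mul, one_mul]
    ring
  have g2 : ∀ T : ℝ, gseg 0 T = (g T : ℂ) := by
    intro T
    rw [g1, ← intervalIntegral.integral_ofReal]
    unfold gseg
    refine intervalIntegral.integral_congr fun s _ => ?_
    push_cast
    simp
  have b1 : ∀ T : ℝ, 0 ≤ T → ‖gseg z T‖ ≤ Real.exp (-(z ^ 2).re) * g T := by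
    intro T hT
    rw [g1, ← intervalIntegral.integral_const_mul]
    unfold gseg
    refine intervalIntegral.norm_integral_le_of_norm_le zero_le_one ?_ (Continuous.intervalIntegrable (by fun_prop) _ _)
    refine Filter.Eventually.of_forall fun s hs => ?_
    rw [norm_mul, Complex.norm_exp, Complex.norm_of_nonneg hT, ← mul_assoc, ← Real.exp_add]
    gcongr
    have : (-(z + s * T) ^ 2 : ℂ).re = -(z ^ 2).re - 2 * (s * T * z.re) - (s * T) ^ 2 := by
      simp [pow_two]; ring
    rw [this]
    have : 0 ≤ s * T * z.re := mul_nonneg (mul_nonneg hs.1.le hT) hz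
    linarith
  have b2 : ∀ T : ℝ, 0 ≤ T → ‖gseg T z‖ ≤ ‖z‖ * Real.exp (‖z‖ ^ 2) * Real.exp (-T) * Real.exp 1 := by
    intro T hT
    unfold gseg
    have := intervalIntegral.norm_integral_le_of_norm_le_const (a := 0) (b := 1) (f := fun s : ℝ => Complex.exp (-(T + s * z) ^ 2) * z)
      (C := ‖z‖ * Real.exp (‖z‖ ^ 2) * Real.exp (-T) * Real.exp 1) ?_
    · simpa using this
    intro s hs
    rw [Set.uIoc_of_le zero_le_one] at hs
    rw [norm_mul, Complex.norm_exp, mul_comm, mul_assoc, mul_assoc, ← Real.exp_add, ← Real.exp_add]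
    gcongr
    have e : (-(T + s * z) ^ 2 : ℂ).re = -T ^ 2 - 2 * (s * T * z.re) - s ^ 2 * (z ^ 2).re := by
      simp [pow_two]; ring
    rw [e]
    have h1 : 0 ≤ s * T * z.re := mul_nonneg (mul_nonneg hs.1.le hT) hz
    have h2 : -(z ^ 2).re ≤ ‖z‖ ^ 2 := by
      rw [← norm_pow]
      exact (neg_le_abs _).trans (Complex.abs_re_le_norm _)
    have h3 : s ^ 2 * (-(z ^ 2).re) ≤ s ^ 2 * ‖z‖ ^ 2 := by gcongr
    have h4 : s ^ 2 * ‖z‖ ^ 2 ≤ 1 * ‖z‖ ^ 2 := by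
      gcongr
      exact pow_le_one₀ hs.1.le hs.2
    nlinarith [sq_nonneg (T - 1)]
  have main : ∀ T : ℝ, 0 ≤ T → ‖(g T : ℂ) - gseg 0 z‖ ≤ Real.exp (-(z ^ 2).re) * g T + ‖z‖ * Real.exp (‖z‖ ^ 2) * Real.exp (-T) * Real.exp 1 := by
    intro T hT
    have h := gseg_add z T
    rw [g2] at h
    have : (g T : ℂ) - gseg 0 z = gseg z T - gseg T z := by linear_combination -h
    rw [this]
    exact (norm_sub_le _ _).trans (add_le_add (b1 T hT) (b2 T hT))
  have hgl : Tendsto g atTop (nhds (Real.sqrt Real.pi / 2)) := gauss_lim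
  have l1 : Tendsto (fun T : ℝ => ‖(g T : ℂ) - gseg 0 z‖) atTop (nhds ‖((Real.sqrt Real.pi / 2 : ℝ) : ℂ) - gseg 0 z‖) :=
    (((Complex.continuous_ofReal.tendsto _).comp hgl).sub_const _).norm
  have l2 : Tendsto (fun T : ℝ => Real.exp (-(z ^ 2).re) * g T + ‖z‖ * Real.exp (‖z‖ ^ 2) * Real.exp (-T) * Real.exp 1) atTop
      (nhds (Real.exp (-(z ^ 2).re) * (Real.sqrt Real.pi / 2) + ‖z‖ * Real.exp (‖z‖ ^ 2) * 0 * Real.exp 1)) :=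
    (hgl.const_mul _).add ((Real.tendsto_exp_neg_atTop_nhds_zero.const_mul _).mul_const _)
  have := le_of_tendsto_of_tendsto l1 l2 ((eventually_ge_atTop 0).mono main)
  simpa using this

/-- polynomial approximation of the error function -/
theorem psi_op (m : ℕ) {N : ℝ} (hN : 0 ≤ N) : ∃ Ψ : Polynomial ℂ, Ψ.natDegree ≤ 2 * m ∧
    (∀ w, Ψ.eval (-w) = -Ψ.eval w) ∧
    ∀ w : ℂ, 0 ≤ w.re → N * ‖w‖ ^ 2 ≤ m / 24 → ‖1 - Ψ.eval w‖ ≤ 3 * Real.exp (-(N * (w ^ 2).re)) := by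
  set κ : ℂ := ((2 / Real.sqrt Real.pi : ℝ) : ℂ) with hκ
  set Ψ : Polynomial ℂ := ∑ j ∈ Finset.range m,
    Polynomial.C (κ * (Real.sqrt N : ℝ) * ((-(N : ℂ)) ^ j / ((j.factorial : ℂ) * (2 * j + 1)))) * Polynomial.X ^ (2 * j + 1) with hΨ
  have hev : ∀ w, Ψ.eval w = ∑ j ∈ Finset.range m, κ * (Real.sqrt N : ℝ) * ((-(N : ℂ)) ^ j / ((j.factorial : ℂ) * (2 * j + 1))) * w ^ (2 * j + 1) := by
    intro w
    simp only [hΨ, Polynomial.eval_finsetSum, Polynomial.eval_mul, Polynomial.eval_C, Polynomial.eval_pow, Polynomial.eval_X]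
  refine ⟨Ψ, ?_, ?_, ?_⟩
  · refine Polynomial.natDegree_sum_le_of_forall_le _ _ fun j hj => ?_
    refine (Polynomial.natDegree_C_mul_X_pow_le _ _).trans ?_
    have := Finset.mem_range.1 hj
    omega
  · intro w
    rw [hev, hev, ← Finset.sum_neg_distrib]
    refine Finset.sum_congr rfl fun j _ => ?_
    rw [Odd.neg_pow ⟨j, rfl⟩]; ring
  · intro w hw hm
    set v : ℂ := (Real.sqrt N : ℝ) * w with hv
    have hsq : ((Real.sqrt N : ℝ) : ℂ) ^ 2 = N := by
      rw [← Complex.ofReal_pow, Real.sq_sqrt hN]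
    have hv2 : v ^ 2 = N * w ^ 2 := by rw [hv, mul_pow, hsq]
    have hvre : 0 ≤ v.re := by
      rw [hv, Complex.re_ofReal_mul]; positivity
    have hvn : ‖v‖ ^ 2 ≤ m / 24 := by
      rw [← norm_pow, hv2, norm_mul, Complex.norm_of_nonneg hN, norm_pow]; exact hm
    have hvr2 : (v ^ 2).re = N * (w ^ 2).re := by rw [hv2, Complex.re_ofReal_mul]
    have e1 : Ψ.eval w = κ * ∫ s in (0 : ℝ)..1, Qt m (-(0 + s * v) ^ 2) * v := by
      rw [hev]
      unfold Qt
      simp_rw [Finset.sum_mul]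
      rw [intervalIntegral.integral_finsetSum (fun i _ => Continuous.intervalIntegrable (by fun_prop) _ _), Finset.mul_sum]
      refine Finset.sum_congr rfl fun j _ => ?_
      have : ∀ s : ℝ, (-(0 + (s : ℂ) * v) ^ 2) ^ j / (j.factorial : ℂ) * v = ((s ^ (2 * j) : ℝ) : ℂ) * ((-v ^ 2) ^ j / (j.factorial : ℂ) * v) := by
        intro s
        rw [zero_add, mul_pow, ← mul_neg, mul_pow, ← pow_mul]
        push_cast; ring
      simp_rw [this]
      rw [intervalIntegral.integral_mul_const, intervalIntegral.integral_ofReal, integral_pow, hv2, hv]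
      have hj : (2 * (j : ℂ) + 1) ≠ 0 := by exact_mod_cast (by positivity : (0 : ℝ) < 2 * j + 1).ne'
      have hf : (j.factorial : ℂ) ≠ 0 := by exact_mod_cast j.factorial_ne_zero
      rw [one_pow, zero_pow (by omega), sub_zero, ← neg_mul, mul_pow, ← pow_mul]
      push_cast
      field_simp
      ring
    have e2 : ‖(∫ s in (0 : ℝ)..1, Qt m (-(0 + s * v) ^ 2) * v) - gseg 0 v‖ ≤ Real.exp (-(N * (w ^ 2).re)) := by
      unfold gseg
      rw [← intervalIntegral.integral_sub (Continuous.intervalIntegrable (by unfold Qt; fun_prop) _ _) (Continuous.intervalIntegrable (by fun_prop) _ _)]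
      have := intervalIntegral.norm_integral_le_of_norm_le_const (a := 0) (b := 1)
        (f := fun s : ℝ => Qt m (-(0 + s * v) ^ 2) * v - Complex.exp (-(0 + s * v) ^ 2) * v)
        (C := Real.exp (-(N * (w ^ 2).re))) ?_
      · simpa using this
      intro s hs
      rw [Set.uIoc_of_le zero_le_one] at hs
      rw [← sub_mul, norm_mul, norm_sub_rev]
      have t := Qt_tail m (-(0 + s * v) ^ 2)
      have n1 : ‖(-(0 + s * v) ^ 2 : ℂ)‖ ≤ m / 24 := by
        rw [zero_add, norm_neg, norm_pow, norm_mul, Complex.norm_of_nonneg hs.1.le, mul_pow]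
        have : s ^ 2 ≤ 1 := pow_le_one₀ hs.1.le hs.2
        nlinarith [sq_nonneg ‖v‖]
      have n2 : ‖v‖ ≤ Real.exp (m / 24) := by
        have := Real.add_one_le_exp ((m : ℝ) / 24)
        nlinarith [sq_nonneg (‖v‖ - 1)]
      have n3 : (v ^ 2).re ≤ m / 24 := (Complex.re_le_norm _).trans (by rw [norm_pow]; exact hvn)
      calc _ ≤ Real.exp (-m + 3 * ‖(-(0 + s * v) ^ 2 : ℂ)‖) * Real.exp (m / 24) := by gcongr
        _ = Real.exp (-m + 3 * ‖(-(0 + s * v) ^ 2 : ℂ)‖ + m / 24) := (Real.exp_add _ _).symm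
        _ ≤ _ := by
          apply Real.exp_le_exp.2
          rw [← hvr2]
          linarith [Nat.cast_nonneg (α := ℝ) m]
    have e3 := gseg_bound hvre
    rw [hvr2] at e3
    have hsp : 1 ≤ Real.sqrt Real.pi := by
      rw [Real.one_le_sqrt]; linarith [Real.pi_gt_three]
    have hκ1 : κ * ((Real.sqrt Real.pi / 2 : ℝ) : ℂ) = 1 := by
      rw [hκ, ← Complex.ofReal_mul]
      have : (2 / Real.sqrt Real.pi) * (Real.sqrt Real.pi / 2) = 1 := by field_simp
      rw [this, Complex.ofReal_one]
    have hκn : ‖κ‖ = 2 / Real.sqrt Real.pi := by rw [hκ, Complex.norm_of_nonneg (by positivity)]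
    have hκ2 : ‖κ‖ ≤ 2 := by rw [hκn]; exact div_le_self (by norm_num) hsp
    have e4 : 1 - Ψ.eval w = κ * (((Real.sqrt Real.pi / 2 : ℝ) : ℂ) - gseg 0 v) -
        κ * ((∫ s in (0 : ℝ)..1, Qt m (-(0 + s * v) ^ 2) * v) - gseg 0 v) := by
      rw [e1, mul_sub, hκ1]; ring
    rw [e4]
    calc _ ≤ ‖κ‖ * ‖((Real.sqrt Real.pi / 2 : ℝ) : ℂ) - gseg 0 v‖ +
          ‖κ‖ * ‖(∫ s in (0 : ℝ)..1, Qt m (-(0 + s * v) ^ 2) * v) - gseg 0 v‖ := by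
          rw [← norm_mul, ← norm_mul]; exact norm_sub_le _ _
      _ ≤ ‖κ‖ * (Real.exp (-(N * (w ^ 2).re)) * (Real.sqrt Real.pi / 2)) + 2 * Real.exp (-(N * (w ^ 2).re)) := by gcongr
      _ = 3 * Real.exp (-(N * (w ^ 2).re)) := by
        rw [hκn]; field_simp; ring


/-- margin -/
def Marg (b R d : ℝ) (w : ℂ) : Prop :=
  d ≤ Real.sin (2 * b) * (w ^ 2).re - Real.cos (2 * b) * (w ^ 2).im ∧
  d ≤ Real.sin (2 * b) * (w ^ 2).re + Real.cos (2 * b) * (w ^ 2).im ∧ d ≤ R ^ 2 - ‖w ^ 2‖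

theorem mix_bound {a a' ψ v : ℂ} {C Mg : ℝ} (hC : 1 ≤ C) (hM : 0 ≤ Mg) (hv : ‖v‖ ≤ Mg) (ha : ‖a‖ ≤ C * Mg)
    (ha' : ‖a'‖ ≤ C * Mg) (hψ : ‖1 - ψ‖ ≤ 3) :
    ‖v - (1 / 2) * (a * (1 + ψ) + a' * (1 - ψ))‖ ≤ 6 * C * Mg := by
  have h1 : ‖1 + ψ‖ ≤ 5 := by
    have : 1 + ψ = 2 - (1 - ψ) := by ring
    rw [this]
    refine (norm_sub_le _ _).trans ?_
    rw [Complex.norm_two]; linarith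
  have h0 : Mg ≤ C * Mg := le_mul_of_one_le_left hM hC
  have h00 : 0 ≤ C * Mg := by positivity
  calc _ ≤ ‖v‖ + ‖(1 / 2 : ℂ) * (a * (1 + ψ) + a' * (1 - ψ))‖ := norm_sub_le _ _
    _ = ‖v‖ + (1 / 2) * ‖a * (1 + ψ) + a' * (1 - ψ)‖ := by rw [norm_mul]; norm_num
    _ ≤ ‖v‖ + (1 / 2) * (‖a‖ * ‖1 + ψ‖ + ‖a'‖ * ‖1 - ψ‖) := by
      rw [← norm_mul, ← norm_mul]; gcongr; exact norm_add_le _ _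
    _ ≤ Mg + (1 / 2) * (C * Mg * 5 + C * Mg * 3) := by gcongr
    _ ≤ _ := by linarith

theorem mix_exp {a a' ψ v : ℂ} {C Mg e : ℝ} (hC : 1 ≤ C) (hM : 0 ≤ Mg) (hv : ‖v‖ ≤ Mg) (ha : ‖v - a‖ ≤ C * Mg * e)
    (ha' : ‖a'‖ ≤ C * Mg) (hψ3 : ‖1 - ψ‖ ≤ 3) (he : 0 ≤ e) (hψ : ‖1 - ψ‖ ≤ 3 * e) :
    ‖v - (1 / 2) * (a * (1 + ψ) + a' * (1 - ψ))‖ ≤ 6 * C * Mg * e := by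
  have h1 : ‖1 + ψ‖ ≤ 5 := by
    have : 1 + ψ = 2 - (1 - ψ) := by ring
    rw [this]
    refine (norm_sub_le _ _).trans ?_
    rw [Complex.norm_two]; linarith
  have h0 : Mg ≤ C * Mg := le_mul_of_one_le_left hM hC
  have h00 : 0 ≤ C * Mg := by positivity
  have e1 : v - (1 / 2) * (a * (1 + ψ) + a' * (1 - ψ)) = (1 / 2) * ((v - a) * (1 + ψ) + (v - a') * (1 - ψ)) := by ring
  have h2 : ‖v - a'‖ ≤ 2 * (C * Mg) := (norm_sub_le _ _).trans (by linarith)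
  rw [e1]
  calc _ = (1 / 2) * ‖(v - a) * (1 + ψ) + (v - a') * (1 - ψ)‖ := by rw [norm_mul]; norm_num
    _ ≤ (1 / 2) * (‖v - a‖ * ‖1 + ψ‖ + ‖v - a'‖ * ‖1 - ψ‖) := by
      rw [← norm_mul, ← norm_mul]; gcongr; exact norm_add_le _ _
    _ ≤ (1 / 2) * (C * Mg * e * 5 + 2 * (C * Mg) * (3 * e)) := by gcongr
    _ ≤ _ := by nlinarith [mul_nonneg h00 he]

theorem bow_op {b R : ℝ} (hb0 : 0 < b) (hb : b ≤ Real.pi / 4) (hR : 0 < R) :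
    ∃ C : ℝ, 1 ≤ C ∧ ∀ (n m : ℕ) (N : ℝ), 4 * m ≤ n → N = m / (24 * R ^ 2) → 1 ≤ N →
    ∀ (g : ℂ → ℂ) (Mg : ℝ), 0 ≤ Mg → ContinuousOn g (sec b R) → DifferentiableOn ℂ g (osec b R) →
      ContinuousOn (fun w => g (-w)) (sec b R) → DifferentiableOn ℂ (fun w => g (-w)) (osec b R) →
      (∀ w ∈ sec b R, ‖g w‖ ≤ Mg) → (∀ w ∈ sec b R, ‖g (-w)‖ ≤ Mg) → ∃ h : Polynomial ℂ, h.natDegree ≤ n ∧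
      (∀ w ∈ sec b R, ‖g w - h.eval w‖ ≤ C * Mg ∧ ‖g (-w) - h.eval (-w)‖ ≤ C * Mg) ∧
      (∀ w ∈ osec b R, ∀ d : ℝ, Marg b R d w →
        ‖g w - h.eval w‖ ≤ C * Mg * Real.exp (-(N * d)) ∧ ‖g (-w) - h.eval (-w)‖ ≤ C * Mg * Real.exp (-(N * d))) := by
  obtain ⟨C, hC, hop⟩ := sector_op hb0 hb hR
  refine ⟨6 * C, by linarith, ?_⟩
  intro n m N hnm hNm hN g Mg hMg hg hgd hg' hgd' hgb hgb'
  have hN0 : 0 ≤ N := by linarith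
  obtain ⟨H, hHd, hHb, hHe⟩ := hop m N hNm hN g Mg hMg hg hgd hgb
  obtain ⟨H', hHd', hHb', hHe'⟩ := hop m N hNm hN (fun w => g (-w)) Mg hMg hg' hgd' hgb'
  obtain ⟨Ψ, hΨd, hΨo, hΨ⟩ := psi_op m hN0
  have hs2 : 0 < Real.sin (2 * b) := Real.sin_pos_of_pos_of_lt_pi (by linarith) (by linarith [Real.pi_pos])
  have hre2 : ∀ w ∈ sec b R, 0 ≤ (w ^ 2).re := by
    intro w hw
    have := sq_mem_sec hb0 hb hw
    have h1 := add_nonneg this.1 this.2.1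
    have h2 : 0 ≤ Real.sin (2 * b) * (w ^ 2).re := by linarith
    exact nonneg_of_mul_nonneg_right h2 hs2
  have hre : ∀ w ∈ sec b R, 0 ≤ w.re := by
    intro w hw
    have h1 := add_nonneg hw.1 hw.2.1
    have h2 : 0 ≤ Real.sin b * w.re := by linarith
    exact nonneg_of_mul_nonneg_right h2 (Real.sin_pos_of_pos_of_lt_pi hb0 (by linarith [Real.pi_pos]))
  have hp : ∀ w ∈ sec b R, ‖1 - Ψ.eval w‖ ≤ 3 * Real.exp (-(N * (w ^ 2).re)) := by
    intro w hw
    refine hΨ w (hre w hw) ?_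
    have : ‖w‖ ≤ R := hw.2.2
    calc N * ‖w‖ ^ 2 ≤ N * R ^ 2 := by gcongr
      _ = (m : ℝ) / 24 := by rw [hNm]; field_simp
  have hp3 : ∀ w ∈ sec b R, ‖1 - Ψ.eval w‖ ≤ 3 := by
    intro w hw
    have : Real.exp (-(N * (w ^ 2).re)) ≤ 1 := Real.exp_le_one_iff.2 (by have := mul_nonneg hN0 (hre2 w hw); linarith)
    linarith [hp w hw]
  have hpd : ∀ w ∈ sec b R, ∀ d, Marg b R d w → ‖1 - Ψ.eval w‖ ≤ 3 * Real.exp (-(N * d)) := by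
    intro w hw d hd
    refine (hp w hw).trans ?_
    have h1 := hre2 w hw
    have h2 : d ≤ Real.sin (2 * b) * (w ^ 2).re := by linarith [hd.1, hd.2.1]
    have h3 : Real.sin (2 * b) * (w ^ 2).re ≤ 1 * (w ^ 2).re := by
      gcongr; exact Real.sin_le_one _
    gcongr
    linarith
  set h : Polynomial ℂ := Polynomial.C (1 / 2) * (H.comp (Polynomial.X ^ 2) * (1 + Ψ) + H'.comp (Polynomial.X ^ 2) * (1 - Ψ)) with hh
  have hev : ∀ w, h.eval w = (1 / 2) * (H.eval (w ^ 2) * (1 + Ψ.eval w) + H'.eval (w ^ 2) * (1 - Ψ.eval w)) := by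
    intro w; simp [hh]
  have hev' : ∀ w, h.eval (-w) = (1 / 2) * (H'.eval (w ^ 2) * (1 + Ψ.eval w) + H.eval (w ^ 2) * (1 - Ψ.eval w)) := by
    intro w; rw [hev, hΨo, neg_sq]; ring
  refine ⟨h, ?_, ?_, ?_⟩
  · refine (Polynomial.natDegree_C_mul_le _ _).trans ?_
    have d0 : ∀ Q : Polynomial ℂ, Q.natDegree ≤ m → (Q.comp (Polynomial.X ^ 2)).natDegree ≤ 2 * m := by
      intro Q hQ
      refine Polynomial.natDegree_comp_le.trans ?_
      rw [Polynomial.natDegree_X_pow]; omega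
    have d1 : (1 + Ψ).natDegree ≤ 2 * m := (Polynomial.natDegree_add_le _ _).trans (max_le (by simp) hΨd)
    have d2 : (1 - Ψ).natDegree ≤ 2 * m := (Polynomial.natDegree_sub_le _ _).trans (max_le (by simp) hΨd)
    refine (Polynomial.natDegree_add_le _ _).trans (max_le ?_ ?_)
    · refine Polynomial.natDegree_mul_le.trans ?_
      have := d0 H hHd; omega
    · refine Polynomial.natDegree_mul_le.trans ?_
      have := d0 H' hHd'; omega
  · intro w hw
    have hZ := sq_mem_sec hb0 hb hw
    rw [hev, hev']
    exact ⟨mix_bound hC hMg (hgb w hw) (hHb _ hZ) (hHb' _ hZ) (hp3 w hw),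
      mix_bound hC hMg (hgb' w hw) (hHb' _ hZ) (hHb _ hZ) (hp3 w hw)⟩
  · intro w hw d hd
    have hws := osec_subset_sec _ _ hw
    have hZ := sq_mem_sec hb0 hb hws
    rw [hev, hev']
    exact ⟨mix_exp hC hMg (hgb w hws) (hHe w hw d hd.1 hd.2.1 hd.2.2) (hHb' _ hZ) (hp3 w hws) (Real.exp_pos _).le (hpd w hws d hd),
      mix_exp hC hMg (hgb' w hws) (hHe' w hw d hd.1 hd.2.1 hd.2.2) (hHb _ hZ) (hp3 w hws) (Real.exp_pos _).le (hpd w hws d hd)⟩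


theorem bowtie_iff {α R : ℝ} (hα1 : 0 < α) (hα2 : α ≤ 1 / 2) (z : ℂ) :
    z ∈ bowtie α R ↔ z ∈ sec (α * Real.pi / 2) R ∨ -z ∈ sec (α * Real.pi / 2) R := by
  have hpi := Real.pi_pos
  have hb0 : 0 < α * Real.pi / 2 := by positivity
  have hb : α * Real.pi / 2 ≤ Real.pi / 2 := by nlinarith
  constructor
  · rintro ⟨r, θ, h1, h2, h3 | h3, rfl⟩
    · exact Or.inl (polar_mem_sec hb h1 h2 h3)
    · right
      have := polar_mem_sec hb h1 h2 h3
      convert this using 1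
      push_cast
      rw [sub_mul, Complex.exp_sub, Complex.exp_pi_mul_I]
      ring
  · rintro (h | h)
    · obtain ⟨r, θ, h1, h2, h3, h4⟩ := exists_polar_sec hb0 hb h
      exact ⟨r, θ, h1, h2, Or.inl h3, h4⟩
    · obtain ⟨r, θ, h1, h2, h3, h4⟩ := exists_polar_sec hb0 hb h
      refine ⟨r, θ + Real.pi, h1, h2, Or.inr (by simpa using h3), ?_⟩
      rw [← neg_neg z, h4]
      push_cast
      rw [add_mul, Complex.exp_add, Complex.exp_pi_mul_I]
      ring

theorem bowtie_neg {α R : ℝ} (hα1 : 0 < α) (hα2 : α ≤ 1 / 2) {z : ℂ} (hz : z ∈ bowtie α R) : -z ∈ bowtie α R := by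
  rw [bowtie_iff hα1 hα2] at *
  rw [neg_neg]; exact hz.symm

theorem bowtie_eq {α R : ℝ} (hα1 : 0 < α) (hα2 : α ≤ 1 / 2) :
    bowtie α R = sec (α * Real.pi / 2) R ∪ (fun z => -z) '' sec (α * Real.pi / 2) R := by
  ext z
  rw [bowtie_iff hα1 hα2]
  constructor
  · rintro (h | h)
    · exact Or.inl h
    · exact Or.inr ⟨-z, h, neg_neg z⟩
  · rintro (h | ⟨w, h, rfl⟩)
    · exact Or.inl h
    · right; simpa using h

theorem isCompact_bowtie {α R : ℝ} (hα1 : 0 < α) (hα2 : α ≤ 1 / 2) : IsCompact (bowtie α R) := by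
  rw [bowtie_eq hα1 hα2]
  exact (isCompact_sec _ _).union ((isCompact_sec _ _).image continuous_neg)

theorem osec_interior {α R : ℝ} (hα1 : 0 < α) (hα2 : α ≤ 1 / 2) {z : ℂ} (hz : z ∈ osec (α * Real.pi / 2) R) :
    z ∈ interior (bowtie α R) := by
  refine mem_interior.2 ⟨osec (α * Real.pi / 2) R, ?_, isOpen_osec _ _, hz⟩
  intro w hw
  exact (bowtie_iff hα1 hα2 w).2 (Or.inl (osec_subset_sec _ _ hw))

theorem neg_interior {α R : ℝ} (hα1 : 0 < α) (hα2 : α ≤ 1 / 2) {z : ℂ} (hz : z ∈ interior (bowtie α R)) :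
    -z ∈ interior (bowtie α R) := by
  obtain ⟨U, hU, hUo, hzU⟩ := mem_interior.1 hz
  refine mem_interior.2 ⟨(fun w => -w) ⁻¹' U, ?_, hUo.preimage continuous_neg, by simpa using hzU⟩
  intro w hw
  have := bowtie_neg hα1 hα2 (hU hw)
  simpa using this

theorem interior_aux {α R : ℝ} (hα1 : 0 < α) (hα2 : α ≤ 1 / 2) (hR : 0 < R) {z : ℂ}
    (hz : z ∈ interior (bowtie α R)) (hs : z ∈ sec (α * Real.pi / 2) R) : z ∈ osec (α * Real.pi / 2) R := by
  have hpi := Real.pi_pos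
  have hb0 : 0 < α * Real.pi / 2 := by positivity
  have hb : α * Real.pi / 2 < Real.pi / 2 := by nlinarith
  set b := α * Real.pi / 2 with hbdef
  have hsb : 0 < Real.sin b := Real.sin_pos_of_pos_of_lt_pi hb0 (by linarith)
  have hcb : 0 < Real.cos b := Real.cos_pos_of_mem_Ioo ⟨by linarith, hb⟩
  obtain ⟨δ, hδ, hball⟩ := Metric.isOpen_iff.1 isOpen_interior z hz
  have hK : ∀ u : ℂ, ‖u‖ < δ → z + u ∈ sec b R ∨ -(z + u) ∈ sec b R := by
    intro u hu
    rw [← bowtie_iff hα1 hα2]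
    apply interior_subset
    apply hball
    rw [Metric.mem_ball, dist_eq_norm]
    simpa using hu
  have hre0 : 0 ≤ z.re := by
    have h2 : 0 ≤ Real.sin b * z.re := by linarith [hs.1, hs.2.1]
    exact nonneg_of_mul_nonneg_right h2 hsb
  -- z is nonzero, real part positive
  have hI : ‖((δ / 2 : ℝ) : ℂ) * Complex.I‖ < δ := by
    rw [norm_mul, Complex.norm_I, Complex.norm_of_nonneg (by positivity)]; linarith
  have hI' : ‖-(((δ / 2 : ℝ) : ℂ) * Complex.I)‖ < δ := by rw [norm_neg]; exact hI
  have rI : (((δ / 2 : ℝ) : ℂ) * Complex.I).re = 0 := by rw [Complex.re_ofReal_mul, Complex.I_re, mul_zero]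
  have iI : (((δ / 2 : ℝ) : ℂ) * Complex.I).im = δ / 2 := by rw [Complex.im_ofReal_mul, Complex.I_im, mul_one]
  have hcd : 0 < Real.cos b * (δ / 2) := by positivity
  have k1 := hK _ hI
  have k2 := hK _ hI'
  simp only [sec, Set.mem_setOf_eq, Complex.neg_re, Complex.neg_im, Complex.add_re, Complex.add_im, rI, iI, neg_zero, add_zero] at k1 k2
  have hrep : 0 < z.re := by
    rcases hre0.lt_or_eq with h | h
    · exact h
    · exfalso
      have a1 := hs.1
      have a2 := hs.2.1
      rw [← h] at a1 a2
      rw [← h] at k1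
      have hi : Real.cos b * z.im = 0 := by linarith
      rcases k1 with ⟨c1, c2, c3⟩ | ⟨c1, c2, c3⟩ <;> nlinarith
  have hsr : 0 < Real.sin b * z.re := by positivity
  refine ⟨?_, ?_, ?_⟩
  · rcases hs.1.lt_or_eq with h | h
    · exact h
    · exfalso
      rcases k1 with ⟨c1, c2, c3⟩ | ⟨c1, c2, c3⟩ <;> nlinarith
  · rcases hs.2.1.lt_or_eq with h | h
    · exact h
    · exfalso
      rcases k2 with ⟨c1, c2, c3⟩ | ⟨c1, c2, c3⟩ <;> nlinarith
  · rcases hs.2.2.lt_or_eq with h | h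
    · exact h
    · exfalso
      have hs0 : 0 < δ / (2 * R) := by positivity
      have h1 : ‖((δ / (2 * R) : ℝ) : ℂ) * z‖ < δ := by
        rw [norm_mul, Complex.norm_of_nonneg (by positivity), h]
        have : δ / (2 * R) * R = δ / 2 := by field_simp
        rw [this]; linarith
      have h2 : ‖z + ((δ / (2 * R) : ℝ) : ℂ) * z‖ = (1 + δ / (2 * R)) * R := by
        have : z + ((δ / (2 * R) : ℝ) : ℂ) * z = ((1 + δ / (2 * R) : ℝ) : ℂ) * z := by push_cast; ring
        rw [this, norm_mul, Complex.norm_of_nonneg (by positivity), h]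
      have h3 : (1 + δ / (2 * R)) * R > R := by nlinarith
      rcases hK _ h1 with c | c
      · have := c.2.2; linarith
      · have := c.2.2
        rw [norm_neg] at this
        linarith

theorem interior_cases {α R : ℝ} (hα1 : 0 < α) (hα2 : α ≤ 1 / 2) (hR : 0 < R) {z : ℂ}
    (hz : z ∈ interior (bowtie α R)) : z ∈ osec (α * Real.pi / 2) R ∨ -z ∈ osec (α * Real.pi / 2) R := by
  rcases (bowtie_iff hα1 hα2 z).1 (interior_subset hz) with h | h
  · exact Or.inl (interior_aux hα1 hα2 hR hz h)
  · exact Or.inr (interior_aux hα1 hα2 hR (neg_interior hα1 hα2 hz) h)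

theorem sq_mem_osec {b R : ℝ} (hb0 : 0 < b) (hb : b ≤ Real.pi / 4) {w : ℂ}
    (hw : w ∈ osec b R) : w ^ 2 ∈ osec (2 * b) (R ^ 2) := by
  obtain ⟨r, θ, h1, h2, h3, rfl⟩ := exists_polar_osec hb0 (by linarith [Real.pi_pos]) hw
  rw [polar_sq]
  refine polar_mem_osec (by linarith) (by positivity) (by gcongr) ?_
  rw [abs_mul, abs_two]; linarith

theorem marg_neg {b R d : ℝ} {w : ℂ} (h : Marg b R d w) : Marg b R d (-w) := by
  unfold Marg at *; rwa [neg_sq]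

theorem compact_marg {α R : ℝ} (hα1 : 0 < α) (hα2 : α ≤ 1 / 2) (hR : 0 < R) {E : Set ℂ} (hE : IsCompact E)
    (hEi : E ⊆ interior (bowtie α R)) : ∃ d : ℝ, 0 < d ∧ ∀ z ∈ E, Marg (α * Real.pi / 2) R d z := by
  have hb0 : 0 < α * Real.pi / 2 := by have := Real.pi_pos; positivity
  have hb : α * Real.pi / 2 ≤ Real.pi / 4 := by nlinarith [Real.pi_pos]
  set b := α * Real.pi / 2
  obtain ⟨d, hd, h⟩ := hE.exists_forall_le' (a := 0)
    (f := fun w : ℂ => min (Real.sin (2 * b) * (w ^ 2).re - Real.cos (2 * b) * (w ^ 2).im)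
      (min (Real.sin (2 * b) * (w ^ 2).re + Real.cos (2 * b) * (w ^ 2).im) (R ^ 2 - ‖w ^ 2‖)))
    (by
      have c1 : Continuous fun w : ℂ => (w ^ 2).re := Complex.continuous_re.comp (continuous_pow 2)
      have c2 : Continuous fun w : ℂ => (w ^ 2).im := Complex.continuous_im.comp (continuous_pow 2)
      exact (((c1.const_mul _).sub (c2.const_mul _)).min (((c1.const_mul _).add (c2.const_mul _)).min
        (by fun_prop))).continuousOn)
    (by
      intro z hz
      have key : z ^ 2 ∈ osec (2 * b) (R ^ 2) := by
        rcases interior_cases hα1 hα2 hR (hEi hz) with h | h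
        · exact sq_mem_osec hb0 hb h
        · have := sq_mem_osec hb0 hb h
          rwa [neg_sq] at this
      exact lt_min key.1 (lt_min key.2.1 (sub_pos.2 key.2.2)))
  refine ⟨d, hd, fun z hz => ?_⟩
  have := h z hz
  simp only [le_min_iff] at this
  exact this

theorem le_supErr {f : ℂ → ℂ} {K : Set ℂ} (hK : IsCompact K) (hf : ContinuousOn f K) (P : Polynomial ℂ) {z : ℂ}
    (hz : z ∈ K) : ‖f z - P.eval z‖ ≤ supErr f K P := by
  obtain ⟨M, hM⟩ := hK.exists_bound_of_continuousOn (hf.sub P.continuous.continuousOn)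
  exact le_ciSup (f := fun z : K => ‖f z - P.eval (z : ℂ)‖) ⟨M, by rintro _ ⟨w, rfl⟩; exact hM w w.2⟩ ⟨z, hz⟩

theorem supErr_nonneg (f : ℂ → ℂ) (K : Set ℂ) (P : Polynomial ℂ) : 0 ≤ supErr f K P :=
  Real.iSup_nonneg fun _ => norm_nonneg _

theorem bestE_nonneg (f : ℂ → ℂ) (K : Set ℂ) (n : ℕ) : 0 ≤ bestE f K n :=
  Real.iInf_nonneg fun _ => supErr_nonneg _ _ _

theorem near_best {f : ℂ → ℂ} {K : Set ℂ} (hK : IsCompact K) (hf : ContinuousOn f K) (hinf : K.Infinite) (n : ℕ) :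
    ∃ q : Polynomial ℂ, q.natDegree ≤ n ∧ ∀ z ∈ K, ‖f z - q.eval z‖ ≤ 2 * bestE f K n := by
  haveI : Nonempty {P : Polynomial ℂ // P.natDegree ≤ n} := ⟨⟨0, by simp⟩⟩
  have hex : ∀ e : ℝ, bestE f K n < e → ∃ q : Polynomial ℂ, q.natDegree ≤ n ∧ ∀ z ∈ K, ‖f z - q.eval z‖ ≤ e := by
    intro e he
    obtain ⟨⟨P, hP⟩, hPe⟩ := exists_lt_of_ciInf_lt he
    exact ⟨P, hP, fun z hz => (le_supErr hK hf P hz).trans hPe.le⟩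
  rcases (bestE_nonneg f K n).lt_or_eq with h | h
  · exact hex _ (by linarith)
  · rw [← h] at hex ⊢
    obtain ⟨s, hsK, hsc⟩ := hinf.exists_subset_card_eq (n + 1)
    classical
    have hinj : Set.InjOn (id : ℂ → ℂ) s := Function.injective_id.injOn
    refine ⟨Lagrange.interpolate s id f, ?_, ?_⟩
    · have := Lagrange.degree_interpolate_lt f hinj
      rw [hsc] at this
      exact Polynomial.natDegree_le_iff_coeff_eq_zero.2 fun N hN =>
        (Polynomial.degree_lt_iff_coeff_zero _ _).1 this N hN
    · intro z hz
      rw [mul_zero]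
      set S : ℝ := ∑ i ∈ s, ‖(Lagrange.basis s id i).eval z‖ with hS
      have hS0 : 0 ≤ S := Finset.sum_nonneg fun _ _ => norm_nonneg _
      have key : ∀ e : ℝ, 0 < e → ‖f z - (Lagrange.interpolate s id f).eval z‖ ≤ e * (1 + S) := by
        intro e he
        obtain ⟨q, hq, hqe⟩ := hex e he
        have hq' : q = Lagrange.interpolate s id (fun i => q.eval i) := by
          refine Lagrange.eq_interpolate_of_eval_eq _ hinj ?_ (fun i _ => rfl)
          rw [hsc]
          exact Polynomial.degree_le_natDegree.trans_lt (by exact_mod_cast Nat.lt_succ_of_le hq)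
        have e1 : q.eval z - (Lagrange.interpolate s id f).eval z =
            ∑ i ∈ s, (q.eval i - f i) * (Lagrange.basis s id i).eval z := by
          conv_lhs => rw [hq']
          rw [Lagrange.interpolate_apply, Lagrange.interpolate_apply, Polynomial.eval_finsetSum, Polynomial.eval_finsetSum,
            ← Finset.sum_sub_distrib]
          refine Finset.sum_congr rfl fun i _ => ?_
          simp only [Polynomial.eval_mul, Polynomial.eval_C]; ring
        have e2 : ‖q.eval z - (Lagrange.interpolate s id f).eval z‖ ≤ e * S := by
          rw [e1, hS, Finset.mul_sum]
          refine norm_sum_le_of_le _ fun i hi => ?_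
          rw [norm_mul, norm_sub_rev]
          gcongr
          exact hqe i (hsK hi)
        calc _ = ‖(f z - q.eval z) + (q.eval z - (Lagrange.interpolate s id f).eval z)‖ := by congr 1; ring
          _ ≤ _ := norm_add_le _ _
          _ ≤ e + e * S := add_le_add (hqe z hz) e2
          _ = _ := by ring
      refine le_of_forall_pos_le_add fun ε hε => ?_
      have := key (ε / (1 + S)) (by positivity)
      rw [div_mul_cancel₀ _ (by positivity)] at this
      linarith


theorem stmt_2 (α R : ℝ) (hα1 : 0 < α) (hα2 : α ≤ 1 / 2) (hR : 0 < R)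
    (f : ℂ → ℂ) (hf_cont : ContinuousOn f (bowtie α R))
    (hf_an : DifferentiableOn ℂ f (interior (bowtie α R))) :
    ∃ (C : ℝ) (p : ℕ → Polynomial ℂ), 1 ≤ C ∧
      (∀ n : ℕ, 1 ≤ n → (p n).natDegree ≤ n) ∧
      (∀ n : ℕ, 1 ≤ n → ∀ z ∈ bowtie α R,
        ‖f z - (p n).eval z‖ ≤ C * bestE f (bowtie α R) n) ∧
      (∀ E : Set ℂ, IsCompact E → E ⊆ interior (bowtie α R) → ∃ c : ℝ, 0 < c ∧
        Tendsto (fun n : ℕ => Real.exp (c * n) * supErr f E (p n)) atTop (nhds 0)) := by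
  have hpi := Real.pi_pos
  have hb0 : 0 < α * Real.pi / 2 := by positivity
  have hb : α * Real.pi / 2 ≤ Real.pi / 4 := by nlinarith
  obtain ⟨C, hC, hop⟩ := bow_op hb0 hb hR
  set b := α * Real.pi / 2 with hbdef
  set K := bowtie α R with hKdef
  have hK : IsCompact K := isCompact_bowtie hα1 hα2
  have hsK : ∀ w ∈ sec b R, w ∈ K := fun w hw => (bowtie_iff hα1 hα2 w).2 (Or.inl hw)
  have hsK' : ∀ w ∈ sec b R, -w ∈ K := fun w hw => bowtie_neg hα1 hα2 (hsK w hw)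
  have hinf : K.Infinite := by
    have h1 : (osec b R).Infinite :=
      infinite_of_mem_nhds ((R / 2 : ℝ) : ℂ) ((isOpen_osec b R).mem_nhds (half_mem_osec hb0 (by linarith) hR))
    exact h1.mono fun w hw => hsK w (osec_subset_sec _ _ hw)
  have step : ∀ n : ℕ, ∃ p : Polynomial ℂ, p.natDegree ≤ n ∧ (∀ z ∈ K, ‖f z - p.eval z‖ ≤ 2 * C * bestE f K n) ∧
      (1 ≤ ((n / 4 : ℕ) : ℝ) / (24 * R ^ 2) → ∀ z ∈ interior K, ∀ d : ℝ, Marg b R d z →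
        ‖f z - p.eval z‖ ≤ 2 * C * bestE f K n * Real.exp (-(((n / 4 : ℕ) : ℝ) / (24 * R ^ 2) * d))) := by
    intro n
    obtain ⟨q, hq, hqe⟩ := near_best hK hf_cont hinf n
    have hB := bestE_nonneg f K n
    by_cases hN : 1 ≤ ((n / 4 : ℕ) : ℝ) / (24 * R ^ 2)
    · have hgc : ContinuousOn (fun z => f z - q.eval z) K := hf_cont.sub q.continuous.continuousOn
      have hgd : DifferentiableOn ℂ (fun z => f z - q.eval z) (interior K) := hf_an.sub q.differentiable.differentiableOn
      have hnegc : ContinuousOn (fun z : ℂ => -z) (sec b R) := continuous_neg.continuousOn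
      have hnegd : DifferentiableOn ℂ (fun z : ℂ => -z) (osec b R) := differentiable_neg.differentiableOn
      obtain ⟨h, hh, hb1, hb2⟩ := hop n (n / 4) _ (Nat.mul_div_le n 4) rfl hN (fun z => f z - q.eval z) (2 * bestE f K n) (by positivity)
        (hgc.mono hsK) (hgd.mono fun w hw => osec_interior hα1 hα2 hw)
        (hgc.comp hnegc hsK') (hgd.comp hnegd fun w hw => neg_interior hα1 hα2 (osec_interior hα1 hα2 hw))
        (fun w hw => hqe w (hsK w hw)) (fun w hw => hqe _ (hsK' w hw))
      have hev : ∀ z, f z - (q + h).eval z = f z - q.eval z - h.eval z := by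
        intro z; rw [Polynomial.eval_add]; ring
      refine ⟨q + h, (Polynomial.natDegree_add_le _ _).trans (max_le hq hh), ?_, ?_⟩
      · intro z hz
        rw [hev]
        have e : 2 * C * bestE f K n = C * (2 * bestE f K n) := by ring
        rw [e]
        rcases (bowtie_iff hα1 hα2 z).1 hz with h1 | h1
        · exact (hb1 z h1).1
        · have := (hb1 _ h1).2
          rwa [neg_neg] at this
      · intro _ z hz d hd
        rw [hev]
        have e : 2 * C * bestE f K n = C * (2 * bestE f K n) := by ring
        rw [e]
        rcases interior_cases hα1 hα2 hR hz with h1 | h1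
        · exact (hb2 z h1 d hd).1
        · have := (hb2 _ h1 d (marg_neg hd)).2
          rwa [neg_neg] at this
    · refine ⟨q, hq, fun z hz => (hqe z hz).trans ?_, fun h => absurd h hN⟩
      nlinarith
  choose p hp1 hp2 hp3 using step
  refine ⟨2 * C, p, by linarith, fun n _ => hp1 n, fun n _ => hp2 n, ?_⟩
  intro E hE hEi
  obtain ⟨d, hd, hm⟩ := compact_marg hα1 hα2 hR hE hEi
  set c : ℝ := d / (192 * R ^ 2) with hc
  have hc0 : 0 < c := by positivity
  refine ⟨c, hc0, ?_⟩
  set B : ℝ := supErr f K 0 with hBdef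
  have hbB : ∀ n, bestE f K n ≤ B := by
    intro n
    exact ciInf_le (f := fun P : {P : Polynomial ℂ // P.natDegree ≤ n} => supErr f K P.1)
      ⟨0, by rintro _ ⟨P, rfl⟩; exact supErr_nonneg _ _ _⟩ ⟨0, by simp⟩
  have hB0 : 0 ≤ B := supErr_nonneg _ _ _
  have hlim : Tendsto (fun n : ℕ => 2 * C * B * Real.exp (8 * c) * Real.exp (-(c * n))) atTop (nhds 0) := by
    have h1 : Tendsto (fun n : ℕ => c * (n : ℝ)) atTop atTop := tendsto_natCast_atTop_atTop.const_mul_atTop hc0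
    have h2 := (Real.tendsto_exp_neg_atTop_nhds_zero.comp h1).const_mul (2 * C * B * Real.exp (8 * c))
    rw [mul_zero] at h2
    exact h2
  refine squeeze_zero' (Eventually.of_forall fun n => mul_nonneg (Real.exp_pos _).le (supErr_nonneg _ _ _)) ?_ hlim
  have hev : ∀ᶠ n : ℕ in atTop, 4 * (24 * R ^ 2) + 4 ≤ (n : ℝ) := tendsto_natCast_atTop_atTop.eventually_ge_atTop _
  filter_upwards [hev] with n hn
  have hq : (n : ℝ) / 4 - 1 ≤ ((n / 4 : ℕ) : ℝ) := by
    have h1 : n ≤ 4 * (n / 4) + 4 := by omega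
    have h2 : (n : ℝ) ≤ 4 * ((n / 4 : ℕ) : ℝ) + 4 := by exact_mod_cast h1
    linarith
  have hN : 1 ≤ ((n / 4 : ℕ) : ℝ) / (24 * R ^ 2) := by
    rw [le_div_iff₀ (by positivity)]; linarith
  have hNd : 2 * (c * n) - 8 * c ≤ ((n / 4 : ℕ) : ℝ) / (24 * R ^ 2) * d := by
    have : ((n : ℝ) / 4 - 1) / (24 * R ^ 2) * d = 2 * (c * n) - 8 * c := by
      rw [hc]; field_simp; ring
    rw [← this]
    gcongr
  have hsup : supErr f E (p n) ≤ 2 * C * B * Real.exp (-(2 * (c * n) - 8 * c)) := by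
    refine Real.iSup_le (fun z => ?_) (by positivity)
    refine (hp3 n hN z (hEi z.2) d (hm z z.2)).trans ?_
    have := hbB n
    gcongr
  calc _ ≤ Real.exp (c * n) * (2 * C * B * Real.exp (-(2 * (c * n) - 8 * c))) := by gcongr
    _ = 2 * C * B * (Real.exp (c * n) * Real.exp (-(2 * (c * n) - 8 * c))) := by ring
    _ = 2 * C * B * (Real.exp (8 * c) * Real.exp (-(c * n))) := by
      rw [← Real.exp_add, ← Real.exp_add]; congr 2; ring
    _ = _ := by ring
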